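/- Let 𝐗 = (X,𝕏) be a level-2 α-Hölder rough path over V, let 𝐙 = (Z,Z') be an 𝐗-controlled rough path with values in U, let F ∈ C_b^3(W, L(U,W)), and let y₀ ∈ W. Then there is exactly one pair (Y,Y') on [0,T] which is an 𝐗-controlled rough path with values in W and satisfies: Y_0 = y₀; Y'_t = F(Y_t) ∘ Z'_t for all t ∈ [0,T]; and Y_t = y₀ + ∫_0^t F(Y_r) dZ_r for all t ∈ [0,T], where ∫_0^t F(Y_r) dZ_r denotes the rough integral of the controlled rough path (F ∘ Y, s ↦ DF(Y_s) ∘ Y'_s) against 𝐙. -/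

import Mathlib

/-!  Common definitions: level-2 rough paths, controlled rough paths,
compensated Riemann sums and rough integrals of a controlled rough path
against another controlled rough path. -/

open scoped BigOperators

noncomputable section

/-- `HBound T β A` : the two-parameter map `A` satisfies a `β`-Hölder bound on the
simplex `{0 ≤ s < t ≤ T}`. -/
def HBound {E : Type*} [NormedAddCommGroup E] (T β : ℝ) (A : ℝ → ℝ → E) : Prop :=
  ∃ C : ℝ, ∀ s t : ℝ, 0 ≤ s → s < t → t ≤ T → ‖A s t‖ ≤ C * (t - s) ^ β

/-- The Hölder seminorm `‖A‖_β = sup_{0 ≤ s < t ≤ T} ‖A_{s,t}‖ / (t-s)^β`, realised as the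
least admissible Hölder constant. -/
def hnorm {E : Type*} [NormedAddCommGroup E] (T β : ℝ) (A : ℝ → ℝ → E) : ℝ :=
  sInf {C : ℝ | 0 ≤ C ∧ ∀ s t : ℝ, 0 ≤ s → s < t → t ≤ T → ‖A s t‖ ≤ C * (t - s) ^ β}

/-- An abstract model of the projective tensor product `V ⊗̂ V`, bundling the canonical
bounded bilinear map `tmul : V × V → V ⊗̂ V` and the pairing `⋆` sending
`A ∈ L(V, L(W,U))` and `B ∈ L(V,W)` to the induced operator `A ⋆ B ∈ L(V ⊗̂ V, U)`,
characterised by `(A ⋆ B)(v₁ ⊗ v₂) = (A v₁)(B v₂)` and `‖A ⋆ B‖ ≤ ‖A‖ ‖B‖`. -/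
structure TensorOps (V V2 W U : Type*)
    [NormedAddCommGroup V] [NormedSpace ℝ V] [NormedAddCommGroup V2] [NormedSpace ℝ V2]
    [NormedAddCommGroup W] [NormedSpace ℝ W] [NormedAddCommGroup U] [NormedSpace ℝ U] where
  tmul : V →L[ℝ] V →L[ℝ] V2
  tmul_le : ∀ a b : V, ‖tmul a b‖ ≤ ‖a‖ * ‖b‖
  spair : (V →L[ℝ] (W →L[ℝ] U)) →L[ℝ] ((V →L[ℝ] W) →L[ℝ] (V2 →L[ℝ] U))
  spair_tmul : ∀ (A : V →L[ℝ] (W →L[ℝ] U)) (B : V →L[ℝ] W) (a b : V),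
    spair A B (tmul a b) = (A a) (B b)
  spair_le : ∀ (A : V →L[ℝ] (W →L[ℝ] U)) (B : V →L[ℝ] W), ‖spair A B‖ ≤ ‖A‖ * ‖B‖

section Defs

variable {V V2 E : Type*}
  [NormedAddCommGroup V] [NormedSpace ℝ V] [NormedAddCommGroup V2] [NormedSpace ℝ V2]
  [NormedAddCommGroup E] [NormedSpace ℝ E]

/-- `(X, XX)` is a level-2 `α`-Hölder rough path on `[0,T]`:
Chen's relation plus the analytic estimates. -/
structure IsRoughPath (T α : ℝ) (tmul : V →L[ℝ] V →L[ℝ] V2)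
    (X : ℝ → V) (XX : ℝ → ℝ → V2) : Prop where
  chen : ∀ s u t : ℝ, 0 ≤ s → s ≤ u → u ≤ t → t ≤ T →
    XX s t = XX s u + XX u t + tmul (X u - X s) (X t - X u)
  x_hold : HBound T α fun s t => X t - X s
  xx_hold : HBound T (2 * α) XX

/-- `‖𝐗‖_α := ‖X‖_α + ‖𝕏‖_{2α}`. -/
def rpNorm (T α : ℝ) (X : ℝ → V) (XX : ℝ → ℝ → V2) : ℝ :=
  hnorm T α (fun s t => X t - X s) + hnorm T (2 * α) XX

/-- `‖𝐗 − 𝐗̃‖_α := ‖X − X̃‖_α + ‖𝕏 − 𝕏̃‖_{2α}`. -/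
def rpDist (T α : ℝ) (X Xt : ℝ → V) (XX XXt : ℝ → ℝ → V2) : ℝ :=
  hnorm T α (fun s t => (X t - X s) - (Xt t - Xt s)) +
    hnorm T (2 * α) fun s t => XX s t - XXt s t

/-- The remainder `R^{𝐘}_{s,t} := Y_{s,t} − Y'_s(X_{s,t})` of a controlled rough path. -/
def Rem (X : ℝ → V) (Y : ℝ → E) (Y' : ℝ → V →L[ℝ] E) (s t : ℝ) : E :=
  Y t - Y s - Y' s (X t - X s)

/-- `(Y, Y')` is an `𝐗`-controlled rough path on `[0,T]` with values in `E`. -/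
structure IsCRP (T α : ℝ) (X : ℝ → V) (Y : ℝ → E) (Y' : ℝ → V →L[ℝ] E) : Prop where
  deriv_hold : HBound T α fun s t => Y' t - Y' s
  rem_hold : HBound T (2 * α) (Rem X Y Y')

/-- `‖𝐘‖_{𝐗;α} := ‖R^{𝐘}‖_{2α} + ‖Y'‖_α`. -/
def crpNorm (T α : ℝ) (X : ℝ → V) (Y : ℝ → E) (Y' : ℝ → V →L[ℝ] E) : ℝ :=
  hnorm T (2 * α) (Rem X Y Y') + hnorm T α fun s t => Y' t - Y' s

/-- `d_{𝐗,𝐗̃;α}(𝐘,𝐘̃) := ‖R^{𝐘} − R^{𝐘̃}‖_{2α} + ‖Y' − Ỹ'‖_α`. -/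
def crpDist (T α : ℝ) (X Xt : ℝ → V) (Y : ℝ → E) (Y' : ℝ → V →L[ℝ] E)
    (Yt : ℝ → E) (Yt' : ℝ → V →L[ℝ] E) : ℝ :=
  hnorm T (2 * α) (fun s t => Rem X Y Y' s t - Rem Xt Yt Yt' s t) +
    hnorm T α fun s t => (Y' t - Y' s) - (Yt' t - Yt' s)

/-- `p` is a finite partition `s = p 0 < p 1 < ⋯ < p n = t` of `[s,t]`. -/
def IsPartition (s t : ℝ) (n : ℕ) (p : ℕ → ℝ) : Prop :=
  p 0 = s ∧ p n = t ∧ ∀ i < n, p i < p (i + 1)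

end Defs

section Sums

variable {V V2 W U : Type*}
  [NormedAddCommGroup V] [NormedSpace ℝ V] [NormedAddCommGroup V2] [NormedSpace ℝ V2]
  [NormedAddCommGroup W] [NormedSpace ℝ W] [NormedAddCommGroup U] [NormedSpace ℝ U]

/-- The compensated Riemann sum
`∫_P Y dZ := Σ_i [ Y_{t_i}(Z_{t_i,t_{i+1}}) + (Y'_{t_i} ⋆ Z'_{t_i})(𝕏_{t_i,t_{i+1}}) ]`. -/
def rsum (tops : TensorOps V V2 W U) (XX : ℝ → ℝ → V2)
    (Y : ℝ → W →L[ℝ] U) (Y' : ℝ → V →L[ℝ] (W →L[ℝ] U))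
    (Z : ℝ → W) (Z' : ℝ → V →L[ℝ] W) (n : ℕ) (p : ℕ → ℝ) : U :=
  ∑ i ∈ Finset.range n,
    ((Y (p i)) (Z (p (i + 1)) - Z (p i)) +
      (tops.spair (Y' (p i)) (Z' (p i))) (XX (p i) (p (i + 1))))

/-- `I` is the rough integral `∫_s^t Y dZ`: the limit of the compensated Riemann sums
as the mesh of the partition tends to `0`. -/
def IsRoughIntegral (tops : TensorOps V V2 W U) (XX : ℝ → ℝ → V2)
    (Y : ℝ → W →L[ℝ] U) (Y' : ℝ → V →L[ℝ] (W →L[ℝ] U))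
    (Z : ℝ → W) (Z' : ℝ → V →L[ℝ] W) (s t : ℝ) (I : U) : Prop :=
  ∀ ε : ℝ, 0 < ε → ∃ δ : ℝ, 0 < δ ∧ ∀ (n : ℕ) (p : ℕ → ℝ), IsPartition s t n p →
    (∀ i < n, p (i + 1) - p i < δ) → ‖rsum tops XX Y Y' Z Z' n p - I‖ ≤ ε

end Sums

/-- The constant `C_α := (1 + T^α + T^{2α}) · 2^{3α} · Σ_{n≥1} n^{-3α}`. -/
def Calpha (T α : ℝ) : ℝ :=
  (1 + T ^ α + T ^ (2 * α)) * (2 : ℝ) ^ (3 * α) * ∑' n : ℕ, ((n : ℝ) + 1) ^ (-(3 * α))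

/-- `F ∈ C_b^k`: `k` times continuously Fréchet differentiable with all derivatives
up to order `k` bounded. -/
def IsCb {E₁ E₂ : Type*} [NormedAddCommGroup E₁] [NormedSpace ℝ E₁]
    [NormedAddCommGroup E₂] [NormedSpace ℝ E₂] (k : ℕ) (F : E₁ → E₂) : Prop :=
  ContDiff ℝ (k : ℕ∞) F ∧ ∀ j ≤ k, ∃ C : ℝ, ∀ x, ‖iteratedFDeriv ℝ j F x‖ ≤ C

/-- `‖F‖_{C_b^k} := Σ_{j=0}^k sup_x ‖D^j F(x)‖`. -/
def cbNorm {E₁ E₂ : Type*} [NormedAddCommGroup E₁] [NormedSpace ℝ E₁]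
    [NormedAddCommGroup E₂] [NormedSpace ℝ E₂] (k : ℕ) (F : E₁ → E₂) : ℝ :=
  ∑ j ∈ Finset.range (k + 1), ⨆ x : E₁, ‖iteratedFDeriv ℝ j F x‖

end

section Auxiliary

variable {E E₁ E₂ E₃ : Type*} [NormedAddCommGroup E] [NormedAddCommGroup E₁]
  [NormedAddCommGroup E₂] [NormedAddCommGroup E₃]

/-- `f` is bounded by `c` and `c`-Lipschitz. -/
def BoundedLip (c : ℝ) (f : E → E₁) : Prop :=
  (∀ x, ‖f x‖ ≤ c) ∧ ∀ x y, ‖f x - f y‖ ≤ c * ‖x - y‖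

/-- A quantitative second-order difference bound, satisfied by maps whose derivative is bounded
and Lipschitz. -/
def FourPoint (c : ℝ) (f : E → E₁) : Prop :=
  ∀ a b a' b', ‖(f a - f b) - (f a' - f b')‖ ≤
    c * (‖(a - b) - (a' - b')‖ + ‖a - b‖ * ‖b - b'‖)

lemma FourPoint.lip {c : ℝ} {f : E → E₁} (h : FourPoint c f) (x y : E) :
    ‖f x - f y‖ ≤ c * ‖x - y‖ := by
  simpa using h x y y y

lemma FourPoint.mono {c c' : ℝ} {f : E → E₁} (h : FourPoint c f) (hc : c ≤ c') :
    FourPoint c' f := fun a b a' b' =>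
  (h a b a' b').trans (mul_le_mul_of_nonneg_right hc (by positivity))

lemma BoundedLip.nonneg {c : ℝ} {f : E → E₁} (h : BoundedLip c f) : 0 ≤ c :=
  (norm_nonneg _).trans (h.1 0)

lemma BoundedLip.mono {c c' : ℝ} {f : E → E₁} (h : BoundedLip c f) (hc : c ≤ c') :
    BoundedLip c' f :=
  ⟨fun x => (h.1 x).trans hc,
    fun x y => (h.2 x y).trans (mul_le_mul_of_nonneg_right hc (norm_nonneg _))⟩

lemma BoundedLip.add {c c' : ℝ} {f g : E → E₁} (hf : BoundedLip c f) (hg : BoundedLip c' g) :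
    BoundedLip (c + c') fun x => f x + g x := by
  refine ⟨fun x => (norm_add_le _ _).trans (add_le_add (hf.1 x) (hg.1 x)), fun x y => ?_⟩
  rw [add_sub_add_comm, add_mul]
  exact (norm_add_le _ _).trans (add_le_add (hf.2 x y) (hg.2 x y))

lemma FourPoint.add {c c' : ℝ} {f g : E → E₁} (hf : FourPoint c f) (hg : FourPoint c' g) :
    FourPoint (c + c') fun x => f x + g x := by
  intro a b a' b'
  rw [add_mul]
  refine le_trans (le_of_eq ?_)
    ((norm_add_le _ _).trans (add_le_add (hf a b a' b') (hg a b a' b')))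
  congr 1
  dsimp only
  abel

lemma BoundedLip.map {c l : ℝ} {f : E → E₁} (hf : BoundedLip c f) (hl : 0 ≤ l) {g : E₁ → E₂}
    (hsub : ∀ a b, g (a - b) = g a - g b) (hg : ∀ a, ‖g a‖ ≤ l * ‖a‖) :
    BoundedLip (l * c) fun x => g (f x) := by
  refine ⟨fun x => (hg _).trans (mul_le_mul_of_nonneg_left (hf.1 x) hl), fun x y => ?_⟩
  rw [← hsub, mul_assoc]
  exact (hg _).trans (mul_le_mul_of_nonneg_left (hf.2 x y) hl)

lemma FourPoint.map {c l : ℝ} {f : E → E₁} (hf : FourPoint c f) (hl : 0 ≤ l) {g : E₁ → E₂}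
    (hsub : ∀ a b, g (a - b) = g a - g b) (hg : ∀ a, ‖g a‖ ≤ l * ‖a‖) :
    FourPoint (l * c) fun x => g (f x) := by
  intro a b a' b'
  simp only [← hsub]
  rw [mul_assoc]
  exact (hg _).trans (mul_le_mul_of_nonneg_left (hf a b a' b') hl)

lemma BoundedLip.bilin {c₁ c₂ : ℝ} {f₁ : E → E₁} {f₂ : E → E₂} (h₁ : BoundedLip c₁ f₁)
    (h₂ : BoundedLip c₂ f₂) {B : E₁ → E₂ → E₃} (hl : ∀ a b c, B (a - b) c = B a c - B b c)
    (hr : ∀ a b c, B a (b - c) = B a b - B a c) (hB : ∀ a b, ‖B a b‖ ≤ ‖a‖ * ‖b‖) :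
    BoundedLip (2 * (c₁ * c₂)) fun x => B (f₁ x) (f₂ x) := by
  have n₁ := h₁.nonneg
  have n₂ := h₂.nonneg
  refine ⟨fun x => ?_, fun x y => ?_⟩
  · refine (hB _ _).trans ((mul_le_mul (h₁.1 x) (h₂.1 x) (norm_nonneg _) n₁).trans ?_)
    nlinarith [mul_nonneg n₁ n₂]
  · have e : B (f₁ x) (f₂ x) - B (f₁ y) (f₂ y) =
        B (f₁ x - f₁ y) (f₂ x) + B (f₁ y) (f₂ x - f₂ y) := by
      rw [hl, hr]; abel
    rw [e]
    calc _ ≤ ‖f₁ x - f₁ y‖ * ‖f₂ x‖ + ‖f₁ y‖ * ‖f₂ x - f₂ y‖ :=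
          (norm_add_le _ _).trans (add_le_add (hB _ _) (hB _ _))
      _ ≤ (c₁ * ‖x - y‖) * c₂ + c₁ * (c₂ * ‖x - y‖) := by
          gcongr
          exacts [h₁.2 x y, h₂.1 x, h₁.1 y, h₂.2 x y]
      _ = _ := by ring

lemma FourPoint.bilin {c₁ c₂ : ℝ} {f₁ : E → E₁} {f₂ : E → E₂} (h₁ : FourPoint c₁ f₁)
    (h₂ : FourPoint c₂ f₂) (b₁ : BoundedLip c₁ f₁) (b₂ : BoundedLip c₂ f₂)
    {B : E₁ → E₂ → E₃} (hl : ∀ a b c, B (a - b) c = B a c - B b c)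
    (hr : ∀ a b c, B a (b - c) = B a b - B a c) (hB : ∀ a b, ‖B a b‖ ≤ ‖a‖ * ‖b‖) :
    FourPoint (6 * (c₁ * c₂)) fun x => B (f₁ x) (f₂ x) := by
  have n₁ := b₁.nonneg
  have n₂ := b₂.nonneg
  intro a b a' b'
  have e : (B (f₁ a) (f₂ a) - B (f₁ b) (f₂ b)) - (B (f₁ a') (f₂ a') - B (f₁ b') (f₂ b')) =
      B ((f₁ a - f₁ b) - (f₁ a' - f₁ b')) (f₂ a') + B (f₁ a - f₁ b) (f₂ a - f₂ a')
      + B (f₁ b') ((f₂ a - f₂ b) - (f₂ a' - f₂ b')) + B (f₁ b - f₁ b') (f₂ a - f₂ b) := by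
    simp only [hl, hr]; abel
  rw [e]
  set d := ‖(a - b) - (a' - b')‖ with hd
  have hd0 : 0 ≤ d := norm_nonneg _
  have haa : ‖a - a'‖ ≤ d + ‖b - b'‖ := by
    have : a - a' = ((a - b) - (a' - b')) + (b - b') := by abel
    rw [this]; exact norm_add_le _ _
  have k2 : ‖f₁ a - f₁ b‖ * ‖f₂ a - f₂ a'‖ ≤ c₁ * c₂ * (2 * d + ‖a - b‖ * ‖b - b'‖) := by
    have i1 : ‖f₁ a - f₁ b‖ ≤ 2 * c₁ := by
      linarith [norm_sub_le (f₁ a) (f₁ b), b₁.1 a, b₁.1 b]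
    have i2 : ‖f₂ a - f₂ a'‖ ≤ c₂ * (d + ‖b - b'‖) := (b₂.2 a a').trans (by gcongr)
    calc _ ≤ ‖f₁ a - f₁ b‖ * (c₂ * (d + ‖b - b'‖)) := by gcongr
      _ = ‖f₁ a - f₁ b‖ * (c₂ * d) + ‖f₁ a - f₁ b‖ * (c₂ * ‖b - b'‖) := by ring
      _ ≤ 2 * c₁ * (c₂ * d) + c₁ * ‖a - b‖ * (c₂ * ‖b - b'‖) := by
          gcongr
          exact b₁.2 a b
      _ = _ := by ring
  have k1 : ‖(f₁ a - f₁ b) - (f₁ a' - f₁ b')‖ * ‖f₂ a'‖ ≤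
      c₁ * (d + ‖a - b‖ * ‖b - b'‖) * c₂ := by
    gcongr
    exacts [h₁ a b a' b', b₂.1 a']
  have k3 : ‖f₁ b'‖ * ‖(f₂ a - f₂ b) - (f₂ a' - f₂ b')‖ ≤
      c₁ * (c₂ * (d + ‖a - b‖ * ‖b - b'‖)) := by
    gcongr
    exacts [b₁.1 b', h₂ a b a' b']
  have k4 : ‖f₁ b - f₁ b'‖ * ‖f₂ a - f₂ b‖ ≤ (c₁ * ‖b - b'‖) * (c₂ * ‖a - b‖) := by
    gcongr
    exacts [b₁.2 b b', b₂.2 a b]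
  have hc : 0 ≤ c₁ * c₂ * d := by positivity
  have hc' : 0 ≤ c₁ * c₂ * (‖a - b‖ * ‖b - b'‖) := by positivity
  have t1 := hB ((f₁ a - f₁ b) - (f₁ a' - f₁ b')) (f₂ a')
  have t2 := hB (f₁ a - f₁ b) (f₂ a - f₂ a')
  have t3 := hB (f₁ b') ((f₂ a - f₂ b) - (f₂ a' - f₂ b'))
  have t4 := hB (f₁ b - f₁ b') (f₂ a - f₂ b)
  refine (norm_add₄_le).trans ?_
  linarith

lemma FourPoint.boundedLip_shift {c m : ℝ} {f : E → E₁} {w : E → E} (hf : FourPoint m f)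
    (hm : 0 ≤ m) (hw : BoundedLip c w) :
    BoundedLip (2 * (m * c)) fun y => f (y + w y) - f y := by
  have hc := hw.nonneg
  refine ⟨fun x => ?_, fun x y => ?_⟩
  · have h := hf.lip (x + w x) x
    rw [add_sub_cancel_left] at h
    have := mul_le_mul_of_nonneg_left (hw.1 x) hm
    nlinarith [mul_nonneg hm hc]
  · refine (hf _ _ _ _).trans ?_
    rw [add_sub_cancel_left, add_sub_cancel_left, two_mul, ← mul_add, mul_assoc]
    refine mul_le_mul_of_nonneg_left ?_ hm
    rw [add_mul]
    gcongr
    exacts [hw.2 x y, hw.1 x]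

/-- Composing perturbations of two maps stays close to a map that nearly composes them. -/
lemma BoundedLip.comp_near {η e₁ e₂ c : ℝ} (hη₀ : 0 ≤ η) (hη : η ≤ 1) {φ₁ φ₂ φ₃ Φ₁ Φ₂ : E → E}
    (h₁ : FourPoint η fun x => φ₁ x - x) (h₂ : FourPoint η fun x => φ₂ x - x)
    (hd : BoundedLip c fun x => φ₂ (φ₁ x) - φ₃ x) (n₁ : BoundedLip e₁ fun x => Φ₁ x - φ₁ x)
    (n₂ : BoundedLip e₂ fun x => Φ₂ x - φ₂ x) (he : e₁ ≤ η) :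
    BoundedLip ((1 + 3 * η) * (e₁ + e₂) + c) fun x => Φ₂ (Φ₁ x) - φ₃ x := by
  have p₁ := n₁.nonneg
  have p₂ := n₂.nonneg
  have hφ₁ : ∀ x y, ‖φ₁ x - φ₁ y‖ ≤ (1 + η) * ‖x - y‖ := fun x y => by
    have := norm_add_le ((φ₁ x - x) - (φ₁ y - y)) (x - y)
    have e : (φ₁ x - x) - (φ₁ y - y) + (x - y) = φ₁ x - φ₁ y := by abel
    rw [e] at this
    linarith [h₁.lip x y]
  refine ⟨fun x => ?_, fun x y => ?_⟩
  · have e : Φ₂ (Φ₁ x) - φ₃ x = (Φ₂ (Φ₁ x) - φ₂ (Φ₁ x)) +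
        (((φ₂ (Φ₁ x) - Φ₁ x) - (φ₂ (φ₁ x) - φ₁ x)) + (Φ₁ x - φ₁ x) + (φ₂ (φ₁ x) - φ₃ x)) := by
      abel
    dsimp only
    rw [e]
    have a1 := n₂.1 (Φ₁ x)
    have a2 := h₂.lip (Φ₁ x) (φ₁ x)
    have a3 := n₁.1 x
    have a4 := hd.1 x
    have a5 := mul_le_mul_of_nonneg_left a3 hη₀
    refine (norm_add_le _ _).trans ((add_le_add a1 (norm_add₃_le.trans
      (add_le_add (add_le_add (a2.trans a5) a3) a4))).trans ?_)
    nlinarith [mul_nonneg hη₀ p₁, mul_nonneg hη₀ p₂]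
  · have e : Φ₂ (Φ₁ x) - φ₃ x - (Φ₂ (Φ₁ y) - φ₃ y) =
        ((Φ₂ (Φ₁ x) - φ₂ (Φ₁ x)) - (Φ₂ (Φ₁ y) - φ₂ (Φ₁ y))) +
        ((((φ₂ (Φ₁ x) - Φ₁ x) - (φ₂ (φ₁ x) - φ₁ x)) - ((φ₂ (Φ₁ y) - Φ₁ y) - (φ₂ (φ₁ y) - φ₁ y)))
          + ((Φ₁ x - φ₁ x) - (Φ₁ y - φ₁ y)) +
          ((φ₂ (φ₁ x) - φ₃ x) - (φ₂ (φ₁ y) - φ₃ y))) := by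
      abel
    dsimp only
    rw [e]
    have a1 := n₂.2 (Φ₁ x) (Φ₁ y)
    have a2 := h₂ (Φ₁ x) (φ₁ x) (Φ₁ y) (φ₁ y)
    have a3 := n₁.2 x y
    have a4 := hd.2 x y
    have a6 : ‖Φ₁ x - Φ₁ y‖ ≤ (1 + 2 * η) * ‖x - y‖ := by
      have := norm_add_le ((Φ₁ x - φ₁ x) - (Φ₁ y - φ₁ y)) (φ₁ x - φ₁ y)
      have e : (Φ₁ x - φ₁ x) - (Φ₁ y - φ₁ y) + (φ₁ x - φ₁ y) = Φ₁ x - Φ₁ y := by abel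
      rw [e] at this
      have := mul_le_mul_of_nonneg_right he (norm_nonneg (x - y))
      linarith [hφ₁ x y]
    have a7 : ‖Φ₁ x - φ₁ x‖ * ‖φ₁ x - φ₁ y‖ ≤ e₁ * ((1 + η) * ‖x - y‖) := by
      gcongr
      exacts [n₁.1 x, hφ₁ x y]
    have a8 := mul_le_mul_of_nonneg_left (add_le_add a3 a7) hη₀
    have a9 := mul_le_mul_of_nonneg_left a6 p₂
    refine (norm_add_le _ _).trans ((add_le_add (a1.trans a9) (norm_add₃_le.trans
      (add_le_add (add_le_add (a2.trans a8) a3) a4))).trans ?_)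
    have q1 : 0 ≤ e₂ * η * ‖x - y‖ := by positivity
    have q2 : 0 ≤ e₁ * η * (1 - η) * ‖x - y‖ :=
      mul_nonneg (mul_nonneg (by positivity) (by linarith)) (norm_nonneg _)
    nlinarith

/-- A stable almost flow on `[0, T]`: each `φ s t` is a smooth perturbation of the identity of size
`(t - s) ^ α`, and the flow property holds up to an error of order `θ`. -/
structure IsAlmostFlow (T α θ C : ℝ) (φ : ℝ → ℝ → E → E) : Prop where
  refl : ∀ t x, 0 ≤ t → t ≤ T → φ t t x = x
  fourPoint : ∀ s t, 0 ≤ s → s ≤ t → t ≤ T → FourPoint (C * (t - s) ^ α) fun x => φ s t x - x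
  defect : ∀ s u t, 0 ≤ s → s ≤ u → u ≤ t → t ≤ T →
    BoundedLip (C * (t - s) ^ θ) fun x => φ u t (φ s u x) - φ s t x

/-- The composition of the maps `φ (p j) (p (j + 1))` for `i ≤ j < i + k`. -/
def eulerFlow {S : Type*} (φ : ℝ → ℝ → S → S) (p : ℕ → ℝ) (i : ℕ) : ℕ → S → S
  | 0, x => x
  | k + 1, x => φ (p (i + k)) (p (i + k + 1)) (eulerFlow φ p i k x)

lemma eulerFlow_add {S : Type*} (φ : ℝ → ℝ → S → S) (p : ℕ → ℝ) (i a b : ℕ) (x : S) :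
    eulerFlow φ p i (a + b) x = eulerFlow φ p (i + a) b (eulerFlow φ p i a x) := by
  induction b with
  | zero => rfl
  | succ b ih => rw [← add_assoc, eulerFlow, eulerFlow, ih, add_assoc i a b]

lemma exists_step_mem {p : ℕ → ℝ} {i k : ℕ} (hk : 0 < k) {m : ℝ} (h₀ : p i ≤ m)
    (h₁ : m ≤ p (i + k)) : ∃ a < k, p (i + a) ≤ m ∧ m ≤ p (i + a + 1) := by
  induction k with
  | zero => exact absurd hk (lt_irrefl _)
  | succ k ih =>
    by_cases hm : p (i + k) ≤ m
    · exact ⟨k, k.lt_succ_self, hm, h₁⟩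
    · rcases Nat.eq_zero_or_pos k with rfl | hk'
      · exact absurd h₀ hm
      · obtain ⟨a, ha, h⟩ := ih hk' (not_le.1 hm).le
        exact ⟨a, ha.trans k.lt_succ_self, h⟩

lemma BoundedLip.zero {c : ℝ} (hc : 0 ≤ c) : BoundedLip c fun _ : E => (0 : E₁) :=
  ⟨fun _ => by simpa using hc, fun x y => by simpa using mul_nonneg hc (norm_nonneg (x - y))⟩

/-- On short time intervals the Euler flows are close to the almost flow, uniformly in the
partition. -/
lemma IsAlmostFlow.exists_near {T α θ C : ℝ} {φ : ℝ → ℝ → E → E} (h : IsAlmostFlow T α θ C φ)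
    (hα : 0 < α) (hθ : 1 < θ) (hC : 0 ≤ C) :
    ∃ L δ : ℝ, 0 ≤ L ∧ 0 < δ ∧ ∀ p : ℕ → ℝ, Monotone p → 0 ≤ p 0 → (∀ i, p i ≤ T) →
      ∀ k i, p (i + k) - p i ≤ δ →
        BoundedLip (L * (p (i + k) - p i) ^ θ)
          (fun x => eulerFlow φ p i k x - φ (p i) (p (i + k)) x) ∧
        L * (p (i + k) - p i) ^ θ ≤ 1 ∧ C * (p (i + k) - p i) ^ α ≤ 1 := by
  set r : ℝ := 2 * (1 / 2 : ℝ) ^ θ with hr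
  have hr1 : r < 1 := by
    have : (1 / 2 : ℝ) ^ θ < (1 / 2 : ℝ) ^ (1 : ℝ) :=
      Real.rpow_lt_rpow_of_exponent_gt (by norm_num) (by norm_num) hθ
    rw [Real.rpow_one] at this
    linarith
  have hr0 : 0 < r := by positivity
  set η : ℝ := (1 - r) / 30 with hη
  have hη0 : 0 < η := by rw [hη]; linarith
  have hη1 : η ≤ 1 := by rw [hη]; linarith
  set L : ℝ := 10 * C / (1 - r) with hL
  have hL0 : 0 ≤ L := div_nonneg (by linarith) (by linarith)
  have hLr : L * (1 - r) = 10 * C := div_mul_cancel₀ _ (by linarith)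
  have small : ∀ c β : ℝ, 0 < β → ∃ δ > 0, ∀ τ, 0 ≤ τ → τ ≤ δ → c * τ ^ β ≤ η := by
    intro c β hβ
    have ht : Filter.Tendsto (fun τ : ℝ => c * τ ^ β) (nhds 0) (nhds (c * (0 : ℝ) ^ β)) :=
      ((Real.continuous_rpow_const hβ.le).tendsto 0).const_mul c
    rw [Real.zero_rpow hβ.ne', mul_zero] at ht
    obtain ⟨δ, hδ, H⟩ := Metric.eventually_nhds_iff.1 (ht.eventually (gt_mem_nhds hη0))
    refine ⟨δ / 2, by positivity, fun τ h0 h1 => (H ?_).le⟩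
    rw [Real.dist_eq, sub_zero, abs_of_nonneg h0]
    linarith
  obtain ⟨δ₁, hδ₁, H₁⟩ := small C α hα
  obtain ⟨δ₂, hδ₂, H₂⟩ := small L θ (by linarith)
  refine ⟨L, min δ₁ δ₂, hL0, lt_min hδ₁ hδ₂, fun p hp hp0 hpT => ?_⟩
  have hpos : ∀ i, 0 ≤ p i := fun i => hp0.trans (hp (Nat.zero_le i))
  intro k
  induction k using Nat.strong_induction_on with
  | _ k ih =>
  intro i hτ
  set τ := p (i + k) - p i with hτd
  have hτ0 : 0 ≤ τ := sub_nonneg.2 (hp (Nat.le_add_right _ _))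
  have hLτ := H₂ τ hτ0 (hτ.trans (min_le_right _ _))
  have hCτ := H₁ τ hτ0 (hτ.trans (min_le_left _ _))
  have hτθ : 0 ≤ τ ^ θ := Real.rpow_nonneg hτ0 _
  refine ⟨?_, hLτ.trans hη1, hCτ.trans hη1⟩
  rcases Nat.eq_zero_or_pos k with rfl | hk
  · simp only [eulerFlow, add_zero, h.refl _ _ (hpos i) (hpT i), sub_self]
    exact BoundedLip.zero (by positivity)
  obtain ⟨a, hak, ha₁, ha₂⟩ := exists_step_mem (p := p) (i := i) hk
    (m := p i + τ / 2) (by linarith) (by linarith)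
  obtain ⟨b, rfl⟩ : ∃ b, k = a + 1 + b := ⟨k - (a + 1), by omega⟩
  have eidx : i + (a + 1) + b = i + (a + 1 + b) := by omega
  have m₁ : p i ≤ p (i + a) := hp (by omega)
  have m₂ : p (i + a) ≤ p (i + a + 1) := hp (by omega)
  have m₃ : p (i + a + 1) ≤ p (i + (a + 1 + b)) := hp (by omega)
  have half : ∀ σ, 0 ≤ σ → σ ≤ τ / 2 → L * σ ^ θ ≤ L * (r / 2) * τ ^ θ := by
    intro σ h0 h1
    have : σ ^ θ ≤ (τ * (1 / 2)) ^ θ := Real.rpow_le_rpow h0 (by linarith) (by linarith)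
    rw [Real.mul_rpow hτ0 (by norm_num)] at this
    have e : (1 / 2 : ℝ) ^ θ = r / 2 := by rw [hr]; ring
    rw [e] at this
    calc L * σ ^ θ ≤ L * (τ ^ θ * (r / 2)) := by gcongr
      _ = _ := by ring
  have fp : ∀ s t, p i ≤ s → s ≤ t → t ≤ p (i + (a + 1 + b)) →
      FourPoint η fun x => φ s t x - x := by
    intro s t h0 h1 h2
    refine (h.fourPoint s t ((hpos i).trans h0) h1 (h2.trans (hpT _))).mono (le_trans ?_ hCτ)
    have : (t - s) ^ α ≤ τ ^ α := Real.rpow_le_rpow (by linarith) (by linarith) hα.le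
    gcongr
  have df : ∀ s u t, p i ≤ s → s ≤ u → u ≤ t → t ≤ p (i + (a + 1 + b)) →
      BoundedLip (C * τ ^ θ) fun x => φ u t (φ s u x) - φ s t x := by
    intro s u t h0 h1 h2 h3
    refine (h.defect s u t ((hpos i).trans h0) h1 h2 (h3.trans (hpT _))).mono ?_
    have : (t - s) ^ θ ≤ τ ^ θ := Real.rpow_le_rpow (by linarith) (by linarith) (by linarith)
    gcongr
  set e₁ := L * (r / 2) * τ ^ θ with he₁
  have he₁0 : 0 ≤ e₁ := by positivity
  have key : (1 + 3 * η) * ((1 + 3 * η) * (e₁ + 0) + C * τ ^ θ + e₁) + C * τ ^ θ ≤ L * τ ^ θ := by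
    have c1 : (1 + 3 * η) * ((1 + 3 * η) + 1) * (r / 2) ≤ (1 + r) / 2 := by
      have i1 : η * r ≤ η := mul_le_of_le_one_right hη0.le hr1.le
      have i2 : η * (η * r) ≤ η * 1 :=
        mul_le_mul_of_nonneg_left (i1.trans hη1) hη0.le
      have i3 : 30 * η = 1 - r := by rw [hη]; ring
      linarith
    have c2 : (1 + 3 * η) * ((1 + 3 * η) * (e₁ + 0) + C * τ ^ θ + e₁) + C * τ ^ θ =
        ((1 + 3 * η) * ((1 + 3 * η) + 1) * (r / 2)) * (L * τ ^ θ) +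
          (2 + 3 * η) * (C * τ ^ θ) := by rw [he₁]; ring
    rw [c2]
    have c3 : 0 ≤ L * τ ^ θ := by positivity
    have c4 : 0 ≤ C * τ ^ θ := by positivity
    have c5 : L * τ ^ θ * (1 - r) = 10 * (C * τ ^ θ) := by
      rw [← mul_assoc, ← hLr]; ring
    nlinarith [mul_le_mul_of_nonneg_right c1 c3, mul_le_mul_of_nonneg_right hη1 c4]
  have g0 : 0 ≤ C * τ ^ θ := by positivity
  have n₁ : BoundedLip e₁ fun x => eulerFlow φ p i a x - φ (p i) (p (i + a)) x :=
    (ih a (by omega) i (by linarith)).1.mono (half _ (by linarith) (by linarith))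
  have n₂ : BoundedLip e₁ fun x => eulerFlow φ p (i + (a + 1)) b x -
      φ (p (i + a + 1)) (p (i + (a + 1 + b))) x := by
    have hi := (ih b (by omega) (i + (a + 1)) (by
      rw [eidx]; have : p (i + (a + 1)) = p (i + a + 1) := rfl; linarith)).1
    rw [eidx] at hi
    refine hi.mono (half _ ?_ ?_)
    · have : p (i + (a + 1)) = p (i + a + 1) := rfl
      linarith
    · have : p (i + (a + 1)) = p (i + a + 1) := rfl
      linarith
  have le1 : (1 + 3 * η) * (e₁ + 0) + C * τ ^ θ ≤ η := by
    refine le_trans ?_ hLτ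
    nlinarith [mul_nonneg hη0.le he₁0, mul_nonneg hη0.le g0,
      mul_nonneg hη0.le (mul_nonneg hη0.le he₁0)]
  have w₁ := BoundedLip.comp_near hη0.le hη1 (fp (p i) (p (i + a)) le_rfl m₁ (m₂.trans m₃))
    (fp (p (i + a)) (p (i + a + 1)) m₁ m₂ m₃)
    (df (p i) (p (i + a)) (p (i + a + 1)) le_rfl m₁ m₂ m₃) n₁
    (Φ₂ := φ (p (i + a)) (p (i + a + 1))) (e₂ := 0)
    (by simpa only [sub_self] using BoundedLip.zero le_rfl)
    (by nlinarith [mul_nonneg hη0.le he₁0])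
  have w₂ := BoundedLip.comp_near hη0.le hη1 (fp (p i) (p (i + a + 1)) le_rfl (m₁.trans m₂) m₃)
    (fp (p (i + a + 1)) (p (i + (a + 1 + b))) (m₁.trans m₂) m₃ le_rfl)
    (df (p i) (p (i + a + 1)) (p (i + (a + 1 + b))) le_rfl (m₁.trans m₂) m₃ le_rfl) w₁ n₂ le1
  simp only [eulerFlow_add φ p i (a + 1) b]
  exact BoundedLip.mono w₂ key

lemma eulerFlow_congr {S : Type*} (φ : ℝ → ℝ → S → S) {p q : ℕ → ℝ} (i : ℕ) {k : ℕ} (x : S)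
    (h : ∀ j ≤ k, p (i + j) = q (i + j)) : eulerFlow φ p i k x = eulerFlow φ q i k x := by
  induction k with
  | zero => rfl
  | succ k ih =>
    rw [eulerFlow, eulerFlow, ih fun j hj => h j (hj.trans k.le_succ), h k k.le_succ,
      add_assoc, h (k + 1) le_rfl]

lemma IsAlmostFlow.lip {T α θ C : ℝ} {φ : ℝ → ℝ → E → E} (h : IsAlmostFlow T α θ C φ)
    {s t : ℝ} (hs : 0 ≤ s) (hst : s ≤ t) (ht : t ≤ T) (x y : E) :
    ‖φ s t x - φ s t y‖ ≤ (1 + C * (t - s) ^ α) * ‖x - y‖ := by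
  have h1 := norm_add_le ((φ s t x - x) - (φ s t y - y)) (x - y)
  have e : (φ s t x - x) - (φ s t y - y) + (x - y) = φ s t x - φ s t y := by abel
  rw [e] at h1
  linarith [(h.fourPoint s t hs hst ht).lip x y]

lemma IsAlmostFlow.exists_lip {T α θ C : ℝ} {φ : ℝ → ℝ → E → E} (h : IsAlmostFlow T α θ C φ)
    (hα : 0 < α) (hθ : 1 < θ) (hC : 0 ≤ C) :
    ∃ K : ℝ, 0 ≤ K ∧ ∀ p : ℕ → ℝ, Monotone p → 0 ≤ p 0 → (∀ i, p i ≤ T) →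
      ∀ k i x y, ‖eulerFlow φ p i k x - eulerFlow φ p i k y‖ ≤ K * ‖x - y‖ := by
  obtain ⟨L, δ, hL, hδ, H⟩ := h.exists_near hα hθ hC
  set K₀ : ℝ := max 3 (1 + C * T ^ α) with hK
  have hK1 : 1 ≤ K₀ := le_trans (by norm_num) (le_max_left _ _)
  obtain ⟨N, hN⟩ := exists_nat_ge (T / δ)
  have hN' : T ≤ N * δ := (div_le_iff₀ hδ).1 hN
  refine ⟨K₀ ^ (2 * N + 1), by positivity, fun p hp hp0 hpT => ?_⟩
  have hpos : ∀ i, 0 ≤ p i := fun i => hp0.trans (hp (Nat.zero_le i))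
  have short : ∀ k i x y, p (i + k) - p i ≤ δ →
      ‖eulerFlow φ p i k x - eulerFlow φ p i k y‖ ≤ K₀ * ‖x - y‖ := by
    intro k i x y hk
    obtain ⟨h1, h2, h3⟩ := H p hp hp0 hpT k i hk
    have h4 := h.lip (hpos i) (hp (Nat.le_add_right i k)) (hpT _) x y
    have h5 := h1.2 x y
    have h6 := norm_add_le ((eulerFlow φ p i k x - φ (p i) (p (i + k)) x) -
      (eulerFlow φ p i k y - φ (p i) (p (i + k)) y))
      (φ (p i) (p (i + k)) x - φ (p i) (p (i + k)) y)
    have e : (eulerFlow φ p i k x - φ (p i) (p (i + k)) x) -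
      (eulerFlow φ p i k y - φ (p i) (p (i + k)) y) +
      (φ (p i) (p (i + k)) x - φ (p i) (p (i + k)) y) =
      eulerFlow φ p i k x - eulerFlow φ p i k y := by abel
    rw [e] at h6
    have n := norm_nonneg (x - y)
    have h7 := mul_le_mul_of_nonneg_right h2 n
    have h8 := mul_le_mul_of_nonneg_right h3 n
    have h9 := mul_le_mul_of_nonneg_right (le_max_left 3 (1 + C * T ^ α)) n
    rw [← hK] at h9
    linarith
  have step : ∀ i x y, ‖φ (p i) (p (i + 1)) x - φ (p i) (p (i + 1)) y‖ ≤ K₀ * ‖x - y‖ := by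
    intro i x y
    refine (h.lip (hpos i) (hp (Nat.le_succ i)) (hpT _) x y).trans ?_
    gcongr
    refine le_trans ?_ (le_max_right _ _)
    have h0 : 0 ≤ p (i + 1) - p i := sub_nonneg.2 (hp (Nat.le_succ i))
    have : (p (i + 1) - p i) ^ α ≤ T ^ α :=
      Real.rpow_le_rpow h0 (by linarith [hpT (i + 1), hpos i]) hα.le
    gcongr
  have main : ∀ N k i x y, p (i + k) - p i ≤ (N : ℕ) * δ →
      ‖eulerFlow φ p i k x - eulerFlow φ p i k y‖ ≤ K₀ ^ (2 * N + 1) * ‖x - y‖ := by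
    intro N
    induction N with
    | zero =>
      intro k i x y hk
      simpa using short k i x y (hk.trans (by simpa using hδ.le))
    | succ N ih =>
      intro k i x y hk
      by_cases hs : p (i + k) - p i ≤ δ
      · refine (short k i x y hs).trans ?_
        gcongr
        exact le_self_pow₀ hK1 (by omega)
      · have hk0 : 0 < k := by
          rcases Nat.eq_zero_or_pos k with rfl | h0
          · exact absurd (by simpa using hδ.le) hs
          · exact h0
        obtain ⟨a, hak, ha₁, ha₂⟩ := exists_step_mem (p := p) (i := i) hk0
          (m := p i + δ) (by linarith) (by linarith)
        obtain ⟨b, rfl⟩ : ∃ b, k = a + 1 + b := ⟨k - (a + 1), by omega⟩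
        have hb : p (i + (a + 1) + b) - p (i + (a + 1)) ≤ N * δ := by
          have e1 : i + (a + 1) + b = i + (a + 1 + b) := by omega
          have e2 : p (i + (a + 1)) = p (i + a + 1) := rfl
          rw [e1, e2]
          push_cast at hk
          linarith
        rw [eulerFlow_add φ p i (a + 1) b, eulerFlow_add φ p i (a + 1) b]
        have k1 := ih b (i + (a + 1)) (eulerFlow φ p i (a + 1) x) (eulerFlow φ p i (a + 1) y) hb
        have k2 := step (i + a) (eulerFlow φ p i a x) (eulerFlow φ p i a y)
        have k3 := short a i x y (by linarith)
        calc _ ≤ K₀ ^ (2 * N + 1) * (K₀ * (K₀ * ‖x - y‖)) := by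
              refine k1.trans ?_
              gcongr
              refine le_trans k2 ?_
              gcongr
          _ = _ := by ring
  intro k i x y
  exact main N k i x y (by linarith [hpT (i + k), hpos i])

lemma norm_sub_eulerFlow_le {φ : ℝ → ℝ → E → E} {p : ℕ → ℝ} {K : ℝ}
    (hK : ∀ k i x y, ‖eulerFlow φ p i k x - eulerFlow φ p i k y‖ ≤ K * ‖x - y‖) (z : ℕ → E)
    (n i : ℕ) : ‖z (i + n) - eulerFlow φ p i n (z i)‖ ≤
      ∑ j ∈ Finset.range n, K * ‖z (i + j + 1) - φ (p (i + j)) (p (i + j + 1)) (z (i + j))‖ := by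
  induction n generalizing i with
  | zero => simp [eulerFlow]
  | succ n ih =>
    have e : eulerFlow φ p i (n + 1) (z i) =
        eulerFlow φ p (i + 1) n (φ (p i) (p (i + 1)) (z i)) := by
      rw [add_comm n 1, eulerFlow_add]; rfl
    have h1 := ih (i + 1)
    have h2 := hK n (i + 1) (z (i + 1)) (φ (p i) (p (i + 1)) (z i))
    have h3 := norm_sub_le_norm_sub_add_norm_sub (z (i + (n + 1)))
      (eulerFlow φ p (i + 1) n (z (i + 1))) (eulerFlow φ p (i + 1) n (φ (p i) (p (i + 1)) (z i)))
    rw [e, Finset.sum_range_succ']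
    refine h3.trans (add_le_add ?_ h2)
    have e2 : i + 1 + n = i + (n + 1) := by omega
    rw [e2] at h1
    refine h1.trans (le_of_eq (Finset.sum_congr rfl fun j _ => ?_))
    have e3 : i + 1 + j = i + (j + 1) := by omega
    rw [e3]

lemma sum_rpow_le {p : ℕ → ℝ} {n : ℕ} {h θ : ℝ} (hθ : 1 < θ) (hp : ∀ i < n, p i ≤ p (i + 1))
    (hh : ∀ i < n, p (i + 1) - p i ≤ h) :
    ∑ i ∈ Finset.range n, (p (i + 1) - p i) ^ θ ≤ h ^ (θ - 1) * (p n - p 0) := by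
  rw [← Finset.sum_range_sub, Finset.mul_sum]
  refine Finset.sum_le_sum fun i hi => ?_
  have hi := Finset.mem_range.1 hi
  have h0 : 0 ≤ p (i + 1) - p i := sub_nonneg.2 (hp i hi)
  have e : (p (i + 1) - p i) ^ θ = (p (i + 1) - p i) ^ (θ - 1) * (p (i + 1) - p i) := by
    rcases h0.eq_or_lt with h0 | h0
    · rw [← h0, Real.zero_rpow (by linarith), mul_zero]
    · rw [← Real.rpow_add_one h0.ne', sub_add_cancel]
  rw [e]
  refine mul_le_mul_of_nonneg_right ?_ h0
  exact Real.rpow_le_rpow h0 (hh i hi) (by linarith)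

/-- The level-`n` dyadic grid of `[0, T]`, stopped at `t`. -/
noncomputable def stoppedGrid (T : ℝ) (n : ℕ) (t : ℝ) (i : ℕ) : ℝ := min (i * (T / 2 ^ n)) t

lemma stoppedGrid_mono {T : ℝ} (hT : 0 ≤ T) (n : ℕ) (t : ℝ) : Monotone (stoppedGrid T n t) := by
  intro i j hij
  unfold stoppedGrid
  gcongr

lemma stoppedGrid_zero {T : ℝ} (n : ℕ) {t : ℝ} (ht : 0 ≤ t) : stoppedGrid T n t 0 = 0 := by
  simp [stoppedGrid, ht]

lemma stoppedGrid_last {T : ℝ} (n : ℕ) {t : ℝ} (ht : t ≤ T) : stoppedGrid T n t (2 ^ n) = t := by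
  have : ((2 ^ n : ℕ) : ℝ) * (T / 2 ^ n) = T := by
    push_cast
    field_simp
  rw [stoppedGrid, this, min_eq_right ht]

lemma stoppedGrid_step {T : ℝ} (hT : 0 ≤ T) (n : ℕ) (t : ℝ) (i : ℕ) :
    stoppedGrid T n t (i + 1) - stoppedGrid T n t i ≤ T / 2 ^ n := by
  have h0 : 0 ≤ T / 2 ^ n := by positivity
  unfold stoppedGrid
  push_cast
  rcases min_cases ((i : ℝ) * (T / 2 ^ n)) t with h | h <;>
    rcases min_cases (((i : ℝ) + 1) * (T / 2 ^ n)) t with h' | h' <;> linarith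

lemma stoppedGrid_succ (T : ℝ) (n : ℕ) (t : ℝ) (i : ℕ) :
    stoppedGrid T (n + 1) t (2 * i) = stoppedGrid T n t i := by
  unfold stoppedGrid
  congr 1
  push_cast
  field_simp
  ring

/-- The path `y` satisfies the Davie estimate for `φ` on short intervals. -/
def IsDaviePath (T θ : ℝ) (φ : ℝ → ℝ → E → E) (y : ℝ → E) : Prop :=
  ∃ L δ : ℝ, 0 ≤ L ∧ 0 < δ ∧ ∀ s t, 0 ≤ s → s ≤ t → t ≤ T → t - s ≤ δ →
    ‖y t - φ s t (y s)‖ ≤ L * (t - s) ^ θ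

lemma tendsto_div_two_pow (T : ℝ) :
    Filter.Tendsto (fun n : ℕ => T / 2 ^ n) Filter.atTop (nhds 0) := by
  simpa [div_eq_mul_inv] using
    (tendsto_pow_atTop_nhds_zero_of_lt_one (r := (2 : ℝ)⁻¹) (by norm_num) (by norm_num)).const_mul T

lemma IsDaviePath.tendsto_eulerFlow {T α θ C : ℝ} {φ : ℝ → ℝ → E → E}
    (h : IsAlmostFlow T α θ C φ) (hT : 0 ≤ T) (hα : 0 < α) (hθ : 1 < θ) (hC : 0 ≤ C) {y : ℝ → E}
    (hy : IsDaviePath T θ φ y) {t : ℝ} (ht0 : 0 ≤ t) (ht : t ≤ T) :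
    Filter.Tendsto (fun n => eulerFlow φ (stoppedGrid T n t) 0 (2 ^ n) (y 0)) Filter.atTop
      (nhds (y t)) := by
  obtain ⟨K, hK, H⟩ := h.exists_lip hα hθ hC
  obtain ⟨L, δ, hL, hδ, hy⟩ := hy
  rw [tendsto_iff_norm_sub_tendsto_zero]
  have lim : Filter.Tendsto (fun n : ℕ => K * L * ((T / 2 ^ n) ^ (θ - 1) * t)) Filter.atTop
      (nhds 0) := by
    have := (((Real.continuous_rpow_const (sub_pos.2 hθ).le).tendsto 0).comp
      (tendsto_div_two_pow T)).mul_const t |>.const_mul (K * L)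
    simpa [Real.zero_rpow (sub_pos.2 hθ).ne', Function.comp_def] using this
  refine squeeze_zero' (Filter.Eventually.of_forall fun n => norm_nonneg _) ?_ lim
  filter_upwards [(tendsto_div_two_pow T).eventually (gt_mem_nhds hδ)] with n hn
  have pT : ∀ i, stoppedGrid T n t i ≤ T := fun i => (min_le_right _ _).trans ht
  have pm := stoppedGrid_mono hT n t
  have p0 := stoppedGrid_zero (T := T) n ht0
  have p1 : ∀ i, 0 ≤ stoppedGrid T n t i := fun i => p0.symm.le.trans (pm (Nat.zero_le i))
  have tel := norm_sub_eulerFlow_le (H _ pm p0.symm.le pT) (fun i => y (stoppedGrid T n t i))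
    (2 ^ n) 0
  simp only [zero_add, p0, stoppedGrid_last n ht] at tel
  rw [norm_sub_rev]
  refine tel.trans ?_
  have sm := sum_rpow_le (p := stoppedGrid T n t) (n := 2 ^ n) hθ (fun i _ => pm i.le_succ)
    (fun i _ => stoppedGrid_step hT n t i)
  rw [p0, stoppedGrid_last n ht, sub_zero] at sm
  refine le_trans ?_ (mul_le_mul_of_nonneg_left sm (mul_nonneg hK hL))
  rw [Finset.mul_sum]
  refine Finset.sum_le_sum fun i _ => ?_
  rw [mul_assoc]
  refine mul_le_mul_of_nonneg_left ?_ hK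
  exact hy _ _ (p1 i) (pm i.le_succ) (pT _) ((stoppedGrid_step hT n t i).trans hn.le)

lemma IsDaviePath.eq {T α θ C : ℝ} {φ : ℝ → ℝ → E → E}
    (h : IsAlmostFlow T α θ C φ) (hT : 0 ≤ T) (hα : 0 < α) (hθ : 1 < θ) (hC : 0 ≤ C)
    {y z : ℝ → E} (hy : IsDaviePath T θ φ y) (hz : IsDaviePath T θ φ z) (h0 : y 0 = z 0)
    {t : ℝ} (ht0 : 0 ≤ t) (ht : t ≤ T) : y t = z t := by
  have h1 := hy.tendsto_eulerFlow h hT hα hθ hC ht0 ht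
  rw [h0] at h1
  exact tendsto_nhds_unique h1 (hz.tendsto_eulerFlow h hT hα hθ hC ht0 ht)

lemma IsAlmostFlow.exists_isDaviePath [CompleteSpace E] {T α θ C : ℝ} {φ : ℝ → ℝ → E → E}
    (h : IsAlmostFlow T α θ C φ) (hT : 0 ≤ T) (hα : 0 < α) (hθ : 1 < θ) (hC : 0 ≤ C) (y₀ : E) :
    ∃ y : ℝ → E, y 0 = y₀ ∧ IsDaviePath T θ φ y := by
  obtain ⟨K, hK, H⟩ := h.exists_lip hα hθ hC
  obtain ⟨L, δ, hL, hδ, N⟩ := h.exists_near hα hθ hC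
  set Y : ℕ → ℝ → E := fun n t => eulerFlow φ (stoppedGrid T n t) 0 (2 ^ n) y₀ with hY
  have pm := fun n t => stoppedGrid_mono hT n t
  have p0 : ∀ n t, 0 ≤ t → stoppedGrid T n t 0 = 0 := fun n t ht => stoppedGrid_zero n ht
  have p1 : ∀ n t, 0 ≤ t → ∀ i, 0 ≤ stoppedGrid T n t i := fun n t ht i =>
    (p0 n t ht).symm.le.trans (pm n t (Nat.zero_le i))
  have pT : ∀ n t, t ≤ T → ∀ i, stoppedGrid T n t i ≤ T := fun n t ht i =>
    (min_le_right _ _).trans ht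
  have cauchy : ∀ t, 0 ≤ t → t ≤ T → CauchySeq fun n => Y n t := by
    intro t ht0 ht
    refine cauchySeq_of_le_geometric ((1 / 2 : ℝ) ^ (θ - 1)) (K * C * (T ^ (θ - 1) * t))
      (Real.rpow_lt_one (by norm_num) (by norm_num) (by linarith)) fun n => ?_
    have tel := norm_sub_eulerFlow_le (H _ (pm n t) (p0 n t ht0).symm.le (pT n t ht))
      (fun i => eulerFlow φ (stoppedGrid T (n + 1) t) 0 (2 * i) y₀) (2 ^ n) 0
    rw [dist_comm, dist_eq_norm]
    have e : (2 : ℕ) ^ (n + 1) = 2 * 2 ^ n := by ring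
    simp only [zero_add, mul_zero] at tel
    have e' : eulerFlow φ (stoppedGrid T (n + 1) t) 0 0 y₀ = y₀ := rfl
    rw [e'] at tel
    simp only [hY, e]
    refine tel.trans ?_
    have sm := sum_rpow_le (p := stoppedGrid T n t) (n := 2 ^ n) hθ (fun i _ => pm n t i.le_succ)
      (fun i _ => stoppedGrid_step hT n t i)
    rw [p0 n t ht0, stoppedGrid_last n ht, sub_zero] at sm
    have e2 : (T / 2 ^ n) ^ (θ - 1) = T ^ (θ - 1) * ((1 / 2 : ℝ) ^ (θ - 1)) ^ n := by
      rw [div_eq_mul_one_div, ← one_div_pow, Real.mul_rpow hT (by positivity),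
        ← Real.rpow_natCast_mul (by norm_num), mul_comm (n : ℝ),
        Real.rpow_mul_natCast (by norm_num)]
    rw [e2] at sm
    refine le_trans ?_ (le_trans (mul_le_mul_of_nonneg_left sm (mul_nonneg hK hC))
      (le_of_eq (by ring)))
    rw [Finset.mul_sum]
    refine Finset.sum_le_sum fun i _ => ?_
    rw [mul_assoc]
    refine mul_le_mul_of_nonneg_left ?_ hK
    have q0 := stoppedGrid_succ T n t i
    have q1 := stoppedGrid_succ T n t (i + 1)
    have e3 : 2 * (i + 1) = 2 * i + 1 + 1 := by ring
    have m1 := pm (n + 1) t (Nat.le_succ (2 * i))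
    have m2 := pm (n + 1) t (Nat.le_succ (2 * i + 1))
    have d := (h.defect _ _ _ (p1 (n + 1) t ht0 (2 * i)) m1 m2 (pT _ _ ht _)).1
      (eulerFlow φ (stoppedGrid T (n + 1) t) 0 (2 * i) y₀)
    rw [e3] at q1 ⊢
    simp only [Nat.succ_eq_add_one] at d
    rw [q0, q1] at d
    simpa only [eulerFlow, zero_add, q0, q1] using d
  choose! y hy using fun t (ht : 0 ≤ t ∧ t ≤ T) =>
    cauchySeq_tendsto_of_complete (cauchy t ht.1 ht.2)
  have lip : ∀ s t, 0 ≤ s → s ≤ t → t ≤ T → ∀ x x', ‖φ s t x - φ s t x'‖ ≤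
      (1 + C * T ^ α) * ‖x - x'‖ := by
    intro s t hs hst ht x x'
    refine (h.lip hs hst ht x x').trans ?_
    have : (t - s) ^ α ≤ T ^ α := Real.rpow_le_rpow (by linarith) (by linarith) hα.le
    gcongr
  refine ⟨y, ?_, ?_⟩
  · refine tendsto_nhds_unique (hy 0 ⟨le_rfl, hT⟩) ?_
    have : ∀ n, Y n 0 = y₀ := by
      intro n
      have hz : ∀ i, stoppedGrid T n 0 i = 0 := fun i => by
        unfold stoppedGrid
        exact min_eq_right (by positivity)
      have : ∀ k, eulerFlow φ (stoppedGrid T n 0) 0 k y₀ = y₀ := by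
        intro k
        induction k with
        | zero => rfl
        | succ k ih => rw [eulerFlow, ih, hz, hz, h.refl _ _ le_rfl hT]
      exact this _
    simp only [this]
    exact tendsto_const_nhds
  · set M : ℝ := (L + C + (1 + C * T ^ α) * L) with hM
    have hTα : 0 ≤ T ^ α := Real.rpow_nonneg hT α
    have hM0 : 0 ≤ M := by positivity
    refine ⟨M, δ / 2, hM0, by positivity, fun s t hs hst ht hδ' => ?_⟩
    have ht0 := hs.trans hst
    have hsT := hst.trans ht
    have cont : Continuous (φ s t) := by
      have : LipschitzWith (Real.toNNReal (1 + C * T ^ α)) (φ s t) :=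
        LipschitzWith.of_dist_le_mul fun x x' => by
          rw [dist_eq_norm, dist_eq_norm, Real.coe_toNNReal _ (by positivity)]
          exact lip s t hs hst ht x x'
      exact this.continuous
    have l1 := ((hy t ⟨ht0, ht⟩).sub ((cont.tendsto _).comp (hy s ⟨hs, hsT⟩))).norm
    have l2 : Filter.Tendsto (fun n : ℕ => M * (t - s + T / 2 ^ n) ^ θ) Filter.atTop
        (nhds (M * (t - s) ^ θ)) := by
      have a1 : Filter.Tendsto (fun n : ℕ => t - s + T / 2 ^ n) Filter.atTop (nhds (t - s)) := by
        simpa using (tendsto_div_two_pow T).const_add (t - s)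
      exact (((Real.continuous_rpow_const (by linarith)).tendsto _).comp a1).const_mul M
    refine le_of_tendsto_of_tendsto l1 l2 ?_
    filter_upwards [(tendsto_div_two_pow T).eventually (gt_mem_nhds (half_pos hδ))] with n hn
    obtain ⟨a, ha, ha₁, ha₂⟩ := exists_step_mem (p := fun i : ℕ => i * (T / 2 ^ n)) (i := 0)
      (k := 2 ^ n) (by positivity) (m := s) (by simpa using hs) (by
        have := stoppedGrid_last n le_rfl (T := T)
        rw [stoppedGrid, min_eq_left_iff.2] at this
        · simp only [zero_add]; rw [this]; exact hsT
        · push_cast; field_simp; exact le_rfl)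
    simp only [zero_add] at ha₁ ha₂
    set g : ℝ := a * (T / 2 ^ n) with hg
    have hg0 : 0 ≤ g := by positivity
    have hsg : s - g ≤ T / 2 ^ n := by
      push_cast at ha₂
      linarith
    have gs : stoppedGrid T n s a = g := min_eq_left ha₁
    have gt : stoppedGrid T n t a = g := min_eq_left (ha₁.trans hst)
    set x := eulerFlow φ (stoppedGrid T n s) 0 a y₀ with hx
    have hx' : eulerFlow φ (stoppedGrid T n t) 0 a y₀ = x := by
      refine eulerFlow_congr φ 0 y₀ fun j hj => ?_
      have : (j : ℝ) * (T / 2 ^ n) ≤ g := by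
        rw [hg]; gcongr
      simp only [zero_add, stoppedGrid]
      rw [min_eq_left (this.trans ha₁), min_eq_left (this.trans (ha₁.trans hst))]
    obtain ⟨b, hb⟩ : ∃ b, 2 ^ n = a + b := ⟨2 ^ n - a, by omega⟩
    have Ys : Y n s = eulerFlow φ (stoppedGrid T n s) a b x := by
      simp only [hY]; rw [hb, eulerFlow_add, zero_add]
    have Yt : Y n t = eulerFlow φ (stoppedGrid T n t) a b x := by
      simp only [hY]; rw [hb, eulerFlow_add, zero_add, hx']
    have ls := stoppedGrid_last n hsT
    have lt := stoppedGrid_last n ht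
    rw [hb] at ls lt
    have Ns := (N _ (pm n s) (p0 n s hs).symm.le (pT n s hsT) b a
      (by rw [ls, gs]; linarith)).1.1 x
    have Nt := (N _ (pm n t) (p0 n t ht0).symm.le (pT n t ht) b a
      (by rw [lt, gt]; linarith)).1.1 x
    dsimp only at Ns Nt
    rw [ls, gs, ← Ys] at Ns
    rw [lt, gt, ← Yt] at Nt
    have D := (h.defect g s t hg0 ha₁ hst ht).1 x
    have Q := lip s t hs hst ht (Y n s) (φ g s x)
    have r1 : (t - g) ^ θ ≤ (t - s + T / 2 ^ n) ^ θ :=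
      Real.rpow_le_rpow (by linarith) (by linarith) (by linarith)
    have r2 : (s - g) ^ θ ≤ (t - s + T / 2 ^ n) ^ θ :=
      Real.rpow_le_rpow (by linarith) (by linarith) (by linarith)
    have e : Y n t - φ s t (Y n s) = (Y n t - φ g t x) - (φ s t (φ g s x) - φ g t x) -
        (φ s t (Y n s) - φ s t (φ g s x)) := by abel
    change ‖Y n t - φ s t (Y n s)‖ ≤ _
    rw [e]
    have b1 := norm_sub_le ((Y n t - φ g t x) - (φ s t (φ g s x) - φ g t x))
      (φ s t (Y n s) - φ s t (φ g s x))
    have b2 := norm_sub_le (Y n t - φ g t x) (φ s t (φ g s x) - φ g t x)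
    have b3 := mul_le_mul_of_nonneg_left r1 hL
    have b4 := mul_le_mul_of_nonneg_left r1 hC
    have b5 : (1 + C * T ^ α) * ‖Y n s - φ g s x‖ ≤
        (1 + C * T ^ α) * (L * (t - s + T / 2 ^ n) ^ θ) := by
      refine mul_le_mul_of_nonneg_left (Ns.trans ?_) (by positivity)
      gcongr
    rw [hM, add_mul, add_mul, mul_assoc (1 + C * T ^ α)]
    linarith

lemma isAlmostFlow_add [NormedSpace ℝ E] {T α θ C : ℝ} {Ξ : ℝ → ℝ → E} (hC : 0 ≤ C)
    (h₀ : ∀ t, 0 ≤ t → t ≤ T → Ξ t t = 0)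
    (hΞ : ∀ s u t, 0 ≤ s → s ≤ u → u ≤ t → t ≤ T →
      ‖Ξ s u + Ξ u t - Ξ s t‖ ≤ C * (t - s) ^ θ) :
    IsAlmostFlow T α θ C fun s t x => x + Ξ s t := by
  refine ⟨fun t x h1 h2 => by rw [h₀ t h1 h2, add_zero], fun s t hs hst ht a b a' b' => ?_,
    fun s u t hs hsu hut ht => ⟨fun x => ?_, fun x y => ?_⟩⟩
  · simp only [add_sub_cancel_left, sub_self, norm_zero]
    have : 0 ≤ (t - s) ^ α := Real.rpow_nonneg (by linarith) _
    positivity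
  · have e : x + Ξ s u + Ξ u t - (x + Ξ s t) = Ξ s u + Ξ u t - Ξ s t := by abel
    dsimp only
    rw [e]
    exact hΞ s u t hs hsu hut ht
  · have e : x + Ξ s u + Ξ u t - (x + Ξ s t) - (y + Ξ s u + Ξ u t - (y + Ξ s t)) = 0 := by abel
    dsimp only
    rw [e, norm_zero]
    have : 0 ≤ (t - s) ^ θ := Real.rpow_nonneg (by linarith) _
    positivity

/-- The sums of `Ξ` over partitions of `[0, t]` converge to `I` as the mesh tends to `0`. -/
def HasMeshLimit (Ξ : ℝ → ℝ → E) (t : ℝ) (I : E) : Prop :=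
  ∀ ε : ℝ, 0 < ε → ∃ δ : ℝ, 0 < δ ∧ ∀ (n : ℕ) (p : ℕ → ℝ), IsPartition 0 t n p →
    (∀ i < n, p (i + 1) - p i < δ) → ‖∑ i ∈ Finset.range n, Ξ (p i) (p (i + 1)) - I‖ ≤ ε

lemma IsPartition.mem_Icc {s t : ℝ} {n : ℕ} {p : ℕ → ℝ} (h : IsPartition s t n p) {i : ℕ}
    (hi : i ≤ n) : s ≤ p i ∧ p i ≤ t := by
  constructor
  · induction i with
    | zero => exact h.1.symm.le
    | succ i ih => exact (ih (by omega)).trans (h.2.2 i (by omega)).le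
  · obtain ⟨k, rfl⟩ := Nat.exists_eq_add_of_le hi
    have : ∀ j ≤ k, p (i + k - j) ≤ t := by
      intro j
      induction j with
      | zero => intro _; exact h.2.1.le
      | succ j ih =>
        intro hj
        have := h.2.2 (i + k - (j + 1)) (by omega)
        rw [show i + k - (j + 1) + 1 = i + k - j by omega] at this
        exact this.le.trans (ih (by omega))
    simpa using this k le_rfl

lemma HasMeshLimit.unique {Ξ : ℝ → ℝ → E} {t : ℝ} (ht : 0 ≤ t) {I J : E}
    (hI : HasMeshLimit Ξ t I) (hJ : HasMeshLimit Ξ t J) : I = J := by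
  refine eq_of_forall_dist_le fun ε hε => ?_
  obtain ⟨δ₁, hδ₁, h₁⟩ := hI (ε / 2) (by positivity)
  obtain ⟨δ₂, hδ₂, h₂⟩ := hJ (ε / 2) (by positivity)
  have : ∃ n p, IsPartition 0 t n p ∧ ∀ i < n, p (i + 1) - p i < min δ₁ δ₂ := by
    rcases ht.eq_or_lt with rfl | ht
    · exact ⟨0, fun _ => 0, ⟨rfl, rfl, by simp⟩, by simp⟩
    · obtain ⟨n, hn⟩ := exists_nat_gt (t / min δ₁ δ₂)
      have hδ := lt_min hδ₁ hδ₂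
      have hn0 : (0 : ℝ) < n := lt_trans (by positivity) hn
      refine ⟨n, fun i => i * (t / n), ⟨by simp, ?_, fun i _ => ?_⟩, fun i _ => ?_⟩
      · field_simp
      · push_cast
        have : 0 < t / n := by positivity
        linarith
      · push_cast
        rw [div_lt_iff₀ hδ] at hn
        have : t / n < min δ₁ δ₂ := by rw [div_lt_iff₀ hn0]; linarith
        linarith
  obtain ⟨n, p, hp, hm⟩ := this
  have a₁ := h₁ n p hp fun i hi => (hm i hi).trans_le (min_le_left _ _)
  have a₂ := h₂ n p hp fun i hi => (hm i hi).trans_le (min_le_right _ _)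
  rw [← dist_eq_norm] at a₁ a₂
  linarith [dist_triangle_left I J (∑ i ∈ Finset.range n, Ξ (p i) (p (i + 1)))]

lemma hasMeshLimit_of_davie {T θ : ℝ} {Ξ : ℝ → ℝ → E} {y : ℝ → E} (hθ : 1 < θ)
    (hy : ∃ L δ : ℝ, 0 ≤ L ∧ 0 < δ ∧ ∀ s t, 0 ≤ s → s ≤ t → t ≤ T → t - s ≤ δ →
      ‖y t - y s - Ξ s t‖ ≤ L * (t - s) ^ θ) {t : ℝ} (ht : t ≤ T) :
    HasMeshLimit Ξ t (y t - y 0) := by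
  obtain ⟨L, δ, hL, hδ, H⟩ := hy
  intro ε hε
  have lim : Filter.Tendsto (fun h : ℝ => L * (h ^ (θ - 1) * t)) (nhds 0) (nhds 0) := by
    have := (((Real.continuous_rpow_const (sub_pos.2 hθ).le).tendsto 0).mul_const t).const_mul L
    simpa [Real.zero_rpow (sub_pos.2 hθ).ne'] using this
  obtain ⟨δ', hδ', H'⟩ := Metric.eventually_nhds_iff.1 (lim.eventually (gt_mem_nhds hε))
  refine ⟨min δ (δ' / 2), lt_min hδ (by positivity), fun n p hp hm => ?_⟩
  have hs : L * ((δ' / 2) ^ (θ - 1) * t) ≤ ε := by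
    refine (H' ?_).le
    rw [Real.dist_eq, sub_zero, abs_of_pos (by positivity)]
    linarith
  refine le_trans ?_ hs
  have sm := sum_rpow_le (p := p) (n := n) hθ (fun i hi => (hp.2.2 i hi).le)
    (fun i hi => ((hm i hi).trans_le (min_le_right _ _)).le)
  rw [hp.1, hp.2.1, sub_zero] at sm
  refine le_trans ?_ (mul_le_mul_of_nonneg_left sm hL)
  have e : y t - y 0 = ∑ i ∈ Finset.range n, (y (p (i + 1)) - y (p i)) := by
    rw [Finset.sum_range_sub (fun i => y (p i)), hp.1, hp.2.1]
  rw [norm_sub_rev, e, ← Finset.sum_sub_distrib, Finset.mul_sum]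
  refine norm_sum_le_of_le _ fun i hi => ?_
  have hi := Finset.mem_range.1 hi
  exact H _ _ (hp.mem_Icc hi.le).1 (hp.2.2 i hi).le ((hp.mem_Icc (Nat.succ_le_of_lt hi)).2.trans ht)
    ((hm i hi).trans_le (min_le_left _ _)).le

lemma HBound.exists_nonneg {T β : ℝ} {A : ℝ → ℝ → E} (h : HBound T β A)
    (h₀ : ∀ t, 0 ≤ t → t ≤ T → A t t = 0) :
    ∃ C : ℝ, 0 ≤ C ∧ ∀ s t, 0 ≤ s → s ≤ t → t ≤ T → ‖A s t‖ ≤ C * (t - s) ^ β := by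
  obtain ⟨C, hC⟩ := h
  refine ⟨max C 0, le_max_right _ _, fun s t hs hst ht => ?_⟩
  have hp : 0 ≤ (t - s) ^ β := Real.rpow_nonneg (by linarith) _
  rcases hst.eq_or_lt with rfl | hst
  · rw [h₀ s hs ht, norm_zero]
    exact mul_nonneg (le_max_right _ _) hp
  · exact (hC s t hs hst ht).trans (mul_le_mul_of_nonneg_right (le_max_left _ _) hp)

section Smooth

variable [NormedSpace ℝ E] [NormedSpace ℝ E₁]

lemma IsCb.fderiv_right {k : ℕ} {F : E → E₁} (hF : IsCb (k + 1) F) : IsCb k (fderiv ℝ F) := by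
  refine ⟨hF.1.fderiv_right (by norm_cast), fun j hj => ?_⟩
  obtain ⟨C, hC⟩ := hF.2 (j + 1) (by omega)
  exact ⟨C, fun x => by rw [norm_iteratedFDeriv_fderiv]; exact hC x⟩

lemma IsCb.differentiable {k : ℕ} {F : E → E₁} (hF : IsCb (k + 1) F) : Differentiable ℝ F :=
  hF.1.differentiable (by norm_cast)

lemma IsCb.exists_boundedLip {k : ℕ} {F : E → E₁} (hF : IsCb (k + 1) F) :
    ∃ M, BoundedLip M F := by
  obtain ⟨C₀, h₀⟩ := hF.2 0 (by omega)
  obtain ⟨C₁, h₁⟩ := hF.2 1 (by omega)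
  refine ⟨max C₀ C₁, fun x => ?_, fun x y => ?_⟩
  · have := h₀ x
    rw [norm_iteratedFDeriv_zero] at this
    exact this.trans (le_max_left _ _)
  · refine convex_univ.norm_image_sub_le_of_norm_fderiv_le (𝕜 := ℝ)
      (fun z _ => hF.differentiable z) (fun z _ => ?_) (Set.mem_univ y) (Set.mem_univ x)
    have := h₁ z
    rw [norm_iteratedFDeriv_one] at this
    exact this.trans (le_max_right _ _)

lemma FourPoint.of_fderiv {M : ℝ} {F : E → E₁} (hF : Differentiable ℝ F)
    (hM : BoundedLip M (fderiv ℝ F)) : FourPoint M F := by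
  intro a b a' b'
  have lip : ∀ x y, ‖F x - F y‖ ≤ M * ‖x - y‖ := fun x y =>
    convex_univ.norm_image_sub_le_of_norm_fderiv_le (𝕜 := ℝ) (fun z _ => hF z)
      (fun z _ => hM.1 z) (Set.mem_univ y) (Set.mem_univ x)
  set d := a - b with hd
  have k1 : ‖(F (b + d) - F b) - (F (b' + d) - F b')‖ ≤ M * ‖d‖ * ‖b - b'‖ := by
    refine convex_univ.norm_image_sub_le_of_norm_hasFDerivWithin_le (𝕜 := ℝ)
      (f := fun z => F (z + d) - F z)
      (f' := fun z => fderiv ℝ F (z + d) - fderiv ℝ F z) (fun z _ => ?_)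
      (fun z _ => ?_) (Set.mem_univ b') (Set.mem_univ b)
    · exact (((hasFDerivAt_comp_add_right d).2 (hF (z + d)).hasFDerivAt).sub
        (hF z).hasFDerivAt).hasFDerivWithinAt
    · simpa using hM.2 (z + d) z
  have k2 := lip (b' + d) a'
  have e1 : b' + d - a' = d - (a' - b') := by abel
  have e2 : b + d = a := by rw [hd]; abel
  rw [e1] at k2
  rw [e2] at k1
  have e : (F a - F b) - (F a' - F b') =
      ((F a - F b) - (F (b' + d) - F b')) + (F (b' + d) - F a') := by abel
  rw [e]
  refine (norm_add_le _ _).trans ((add_le_add k1 k2).trans (le_of_eq ?_))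
  ring

lemma IsCb.exists_fourPoint {k : ℕ} {F : E → E₁} (hF : IsCb (k + 2) F) : ∃ M, FourPoint M F := by
  obtain ⟨M, hM⟩ := hF.fderiv_right.exists_boundedLip
  exact ⟨M, FourPoint.of_fderiv hF.differentiable hM⟩

lemma BoundedLip.taylor {M c : ℝ} {F : E → E₁} {w : E → E} (hF : Differentiable ℝ F)
    (hM : FourPoint M (fderiv ℝ F)) (hM₀ : 0 ≤ M) (hw : BoundedLip c w) :
    BoundedLip (2 * (M * c ^ 2)) fun y => F (y + w y) - F y - fderiv ℝ F y (w y) := by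
  have hc := hw.nonneg
  have hder : ∀ y v, HasFDerivAt (fun v => F (y + v) - F y - fderiv ℝ F y v)
      (fderiv ℝ F (y + v) - fderiv ℝ F y) v := fun y v => by
    have := ((hasFDerivAt_comp_add_left y).2 (hF (y + v)).hasFDerivAt).sub_const (F y)
    exact this.sub (fderiv ℝ F y).hasFDerivAt
  have hconv := convex_closedBall (0 : E) c
  have mem0 : (0 : E) ∈ Metric.closedBall (0 : E) c := Metric.mem_closedBall_self hc
  have memw : ∀ y, w y ∈ Metric.closedBall (0 : E) c := fun y => by
    rw [mem_closedBall_zero_iff]; exact hw.1 y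
  have k1 : ∀ y, ∀ v ∈ Metric.closedBall (0 : E) c, ∀ v' ∈ Metric.closedBall (0 : E) c,
      ‖(F (y + v) - F y - fderiv ℝ F y v) - (F (y + v') - F y - fderiv ℝ F y v')‖ ≤
        M * c * ‖v - v'‖ := by
    intro y v hv v' hv'
    refine hconv.norm_image_sub_le_of_norm_hasFDerivWithin_le (𝕜 := ℝ)
      (f := fun v => F (y + v) - F y - fderiv ℝ F y v)
      (fun z _ => (hder y z).hasFDerivWithinAt) (fun z hz => ?_) hv' hv
    have := hM.lip (y + z) y
    rw [add_sub_cancel_left] at this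
    rw [mem_closedBall_zero_iff] at hz
    exact this.trans (by gcongr)
  have k2 : ∀ y y' : E, ∀ v ∈ Metric.closedBall (0 : E) c,
      ‖(F (y + v) - F y - fderiv ℝ F y v) - (F (y' + v) - F y' - fderiv ℝ F y' v)‖ ≤
        M * c * ‖y - y'‖ * c := by
    intro y y' v hv
    have := hconv.norm_image_sub_le_of_norm_hasFDerivWithin_le (𝕜 := ℝ)
      (f := fun v => (F (y + v) - F y - fderiv ℝ F y v) - (F (y' + v) - F y' - fderiv ℝ F y' v))
      (C := M * c * ‖y - y'‖)
      (fun z _ => ((hder y z).sub (hder y' z)).hasFDerivWithinAt) (fun z hz => ?_) mem0 hv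
    · rw [mem_closedBall_zero_iff] at hv
      have hM' : 0 ≤ M * c * ‖y - y'‖ := by positivity
      simp only [add_zero, sub_self, map_zero, sub_zero] at this
      exact this.trans (by gcongr)
    · have := hM (y + z) y (y' + z) y'
      rw [add_sub_cancel_left, add_sub_cancel_left, sub_self, norm_zero, zero_add] at this
      rw [mem_closedBall_zero_iff] at hz
      refine this.trans ?_
      rw [mul_assoc]
      gcongr
  refine ⟨fun y => ?_, fun y y' => ?_⟩
  · have := k1 y (w y) (memw y) 0 mem0
    simp only [add_zero, sub_self, map_zero, sub_zero] at this
    refine this.trans ?_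
    have h2 := mul_le_mul_of_nonneg_left (hw.1 y) (mul_nonneg hM₀ hc)
    have h3 : 0 ≤ M * c ^ 2 := by positivity
    linarith [show M * c * c = M * c ^ 2 by ring]
  · have h1 := k2 y y' (w y) (memw y)
    have h2 := k1 y' (w y) (memw y) (w y') (memw y')
    have h3 := mul_le_mul_of_nonneg_left (hw.2 y y') (mul_nonneg hM₀ hc)
    refine (norm_sub_le_norm_sub_add_norm_sub _
      (F (y' + w y) - F y' - fderiv ℝ F y' (w y)) _).trans ?_
    refine (add_le_add h1 (h2.trans h3)).trans (le_of_eq ?_)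
    ring

end Smooth

section RoughEquation

variable {V V2 W U : Type*} [NormedAddCommGroup V] [NormedSpace ℝ V]
  [NormedAddCommGroup V2] [NormedSpace ℝ V2] [NormedAddCommGroup W] [NormedSpace ℝ W]
  [NormedAddCommGroup U] [NormedSpace ℝ U]

/-- A common bound `C` for all the Hölder norms of a rough path and a controlled integrator. -/
structure DriverBound (T α C : ℝ) (tmul : V →L[ℝ] V →L[ℝ] V2) (X : ℝ → V) (XX : ℝ → ℝ → V2)
    (Z : ℝ → U) (Z' : ℝ → V →L[ℝ] U) : Prop where
  nonneg : 0 ≤ C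
  time : ∀ s t, 0 ≤ s → s ≤ t → t ≤ T → (t - s) ^ α ≤ C
  chen : ∀ s u t, 0 ≤ s → s ≤ u → u ≤ t → t ≤ T →
    XX s t = XX s u + XX u t + tmul (X u - X s) (X t - X u)
  path : ∀ s t, 0 ≤ s → s ≤ t → t ≤ T → ‖X t - X s‖ ≤ C * (t - s) ^ α
  area : ∀ s t, 0 ≤ s → s ≤ t → t ≤ T → ‖XX s t‖ ≤ C * ((t - s) ^ α) ^ 2
  integrator : ∀ s t, 0 ≤ s → s ≤ t → t ≤ T → ‖Z t - Z s‖ ≤ C * (t - s) ^ α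
  deriv_le : ∀ t, 0 ≤ t → t ≤ T → ‖Z' t‖ ≤ C
  deriv : ∀ s t, 0 ≤ s → s ≤ t → t ≤ T → ‖Z' t - Z' s‖ ≤ C * (t - s) ^ α
  rem : ∀ s t, 0 ≤ s → s ≤ t → t ≤ T →
    ‖Z t - Z s - Z' s (X t - X s)‖ ≤ C * ((t - s) ^ α) ^ 2

lemma rpow_two_mul {x : ℝ} (hx : 0 ≤ x) (α : ℝ) : x ^ (2 * α) = (x ^ α) ^ 2 := by
  rw [mul_comm, Real.rpow_mul hx]
  norm_cast

lemma rpow_three_mul {x : ℝ} (hx : 0 ≤ x) (α : ℝ) : x ^ (3 * α) = (x ^ α) ^ 3 := by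
  rw [mul_comm, Real.rpow_mul hx]
  norm_cast

lemma IsRoughPath.diag {T α : ℝ} {tmul : V →L[ℝ] V →L[ℝ] V2} {X : ℝ → V} {XX : ℝ → ℝ → V2}
    (hX : IsRoughPath T α tmul X XX) {t : ℝ} (h₀ : 0 ≤ t) (h₁ : t ≤ T) : XX t t = 0 := by
  have := hX.chen t t t h₀ le_rfl le_rfl h₁
  simpa using this

lemma IsRoughPath.exists_driverBound {T α : ℝ} (hα : 0 < α)
    {tmul : V →L[ℝ] V →L[ℝ] V2} {X : ℝ → V} {XX : ℝ → ℝ → V2} (hX : IsRoughPath T α tmul X XX)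
    {Z : ℝ → U} {Z' : ℝ → V →L[ℝ] U} (hZ : IsCRP T α X Z Z') :
    ∃ C, DriverBound T α C tmul X XX Z Z' := by
  obtain ⟨C₁, n₁, h₁⟩ := hX.x_hold.exists_nonneg fun t _ _ => sub_self _
  obtain ⟨C₂, n₂, h₂⟩ := hX.xx_hold.exists_nonneg fun t h h' => hX.diag h h'
  obtain ⟨C₃, n₃, h₃⟩ := hZ.deriv_hold.exists_nonneg fun t _ _ => sub_self _
  obtain ⟨C₄, n₄, h₄⟩ := hZ.rem_hold.exists_nonneg fun t _ _ => by simp [Rem]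
  set A : ℝ := |T| ^ α with hA
  have hA0 : 0 ≤ A := by positivity
  set B : ℝ := ‖Z' 0‖ + C₃ * A with hB
  have hB0 : 0 ≤ B := by positivity
  have time : ∀ s t, 0 ≤ s → s ≤ t → t ≤ T → (t - s) ^ α ≤ A := fun s t hs hst ht =>
    Real.rpow_le_rpow (by linarith) (by linarith [le_abs_self T]) hα.le
  have d : ∀ t, 0 ≤ t → t ≤ T → ‖Z' t‖ ≤ B := fun t h0 h1 => by
    have e1 := h₃ 0 t le_rfl h0 h1
    have e2 := mul_le_mul_of_nonneg_left (time 0 t le_rfl h0 h1) n₃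
    have e3 := norm_le_norm_add_norm_sub' (Z' t) (Z' 0)
    linarith
  have hBC : 0 ≤ B * C₁ := by positivity
  have hCA : 0 ≤ C₄ * A := by positivity
  refine ⟨A + B + C₁ + C₂ + C₃ + C₄ + C₄ * A + B * C₁, by positivity, fun s t hs hst ht => ?_,
    hX.chen, fun s t hs hst ht => ?_, fun s t hs hst ht => ?_, fun s t hs hst ht => ?_,
    fun t h0 h1 => ?_, fun s t hs hst ht => ?_, fun s t hs hst ht => ?_⟩
  · linarith [time s t hs hst ht]
  · have : 0 ≤ (t - s) ^ α := Real.rpow_nonneg (by linarith) _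
    refine (h₁ s t hs hst ht).trans (mul_le_mul_of_nonneg_right ?_ this)
    linarith
  · have := h₂ s t hs hst ht
    rw [rpow_two_mul (by linarith)] at this
    refine this.trans (mul_le_mul_of_nonneg_right ?_ (by positivity))
    linarith
  · have ha : 0 ≤ (t - s) ^ α := Real.rpow_nonneg (by linarith) _
    have e1 := h₄ s t hs hst ht
    rw [rpow_two_mul (by linarith)] at e1
    have e2 := (Z' s).le_of_opNorm_le (d s hs (hst.trans ht)) (X t - X s)
    have e3 := mul_le_mul_of_nonneg_left (h₁ s t hs hst ht) hB0
    have e4 : C₄ * ((t - s) ^ α) ^ 2 ≤ C₄ * A * (t - s) ^ α := by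
      rw [pow_two, ← mul_assoc]
      have := time s t hs hst ht
      gcongr
    have e5 := norm_add_le (Rem X Z Z' s t) (Z' s (X t - X s))
    rw [Rem, sub_add_cancel] at e5
    rw [Rem] at e1
    have e6 : (C₄ * A + B * C₁) * (t - s) ^ α ≤
        (A + B + C₁ + C₂ + C₃ + C₄ + C₄ * A + B * C₁) * (t - s) ^ α :=
      mul_le_mul_of_nonneg_right (by linarith) ha
    linarith
  · linarith [d t h0 h1]
  · have : 0 ≤ (t - s) ^ α := Real.rpow_nonneg (by linarith) _
    refine (h₃ s t hs hst ht).trans (mul_le_mul_of_nonneg_right ?_ this)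
    linarith
  · have := h₄ s t hs hst ht
    rw [rpow_two_mul (by linarith)] at this
    refine this.trans (mul_le_mul_of_nonneg_right ?_ (by positivity))
    linarith

/-- The local second-order expansion of the rough integral. -/
noncomputable def germ (tops : TensorOps V V2 U W) (XX : ℝ → ℝ → V2) (Z : ℝ → U)
    (Z' : ℝ → V →L[ℝ] U) (G : U →L[ℝ] W) (G' : V →L[ℝ] U →L[ℝ] W) (s t : ℝ) : W :=
  G (Z t - Z s) + tops.spair G' (Z' s) (XX s t)

lemma TensorOps.norm_spair_apply_le (tops : TensorOps V V2 U W) (A : V →L[ℝ] U →L[ℝ] W)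
    (B : V →L[ℝ] U) (x : V2) : ‖tops.spair A B x‖ ≤ ‖A‖ * ‖B‖ * ‖x‖ :=
  (tops.spair A B).le_of_opNorm_le (tops.spair_le A B) x

lemma germ_defect (tops : TensorOps V V2 U W) {X : ℝ → V} {XX : ℝ → ℝ → V2} (Z : ℝ → U)
    (Z' : ℝ → V →L[ℝ] U) (G₁ G₂ : U →L[ℝ] W) (G₁' G₂' : V →L[ℝ] U →L[ℝ] W) {s u t : ℝ}
    (hc : XX s t = XX s u + XX u t + tops.tmul (X u - X s) (X t - X u)) :
    germ tops XX Z Z' G₁ G₁' s u + germ tops XX Z Z' G₂ G₂' u t - germ tops XX Z Z' G₁ G₁' s t =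
      (G₂ - G₁ - G₁' (X u - X s)) (Z t - Z u)
      + G₁' (X u - X s) (Z t - Z u - Z' u (X t - X u))
      + G₁' (X u - X s) ((Z' u - Z' s) (X t - X u))
      + (tops.spair G₂' (Z' u) (XX u t) - tops.spair G₁' (Z' s) (XX u t)) := by
  have e : Z t - Z s = (Z u - Z s) + (Z t - Z u) := by abel
  simp only [germ]
  rw [hc, e]
  simp only [map_add, tops.spair_tmul, _root_.sub_apply, map_sub]
  abel

/-- The one-step map of the rough differential equation. -/
noncomputable def rdeStep (tops : TensorOps V V2 U W) (XX : ℝ → ℝ → V2) (Z : ℝ → U)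
    (Z' : ℝ → V →L[ℝ] U) (F : W → U →L[ℝ] W) (s t : ℝ) (y : W) : W :=
  y + germ tops XX Z Z' (F y) ((fderiv ℝ F y).comp ((F y).comp (Z' s))) s t

variable {T α C M : ℝ} {tops : TensorOps V V2 U W} {X : ℝ → V} {XX : ℝ → ℝ → V2} {Z : ℝ → U}
  {Z' : ℝ → V →L[ℝ] U} {F : W → U →L[ℝ] W}

lemma BoundedLip.fderiv_comp (b₀ : BoundedLip M F) (b₁ : BoundedLip M (fderiv ℝ F)) :
    BoundedLip (2 * (M * M)) fun y => (fderiv ℝ F y).comp (F y) :=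
  b₁.bilin b₀ (B := fun A B => A.comp B) (fun _ _ _ => ContinuousLinearMap.sub_comp _ _ _)
    (fun _ _ _ => ContinuousLinearMap.comp_sub _ _ _) fun a b => a.opNorm_comp_le b

lemma FourPoint.fderiv_comp (b₀ : BoundedLip M F) (b₁ : BoundedLip M (fderiv ℝ F))
    (f₀ : FourPoint M F) (f₁ : FourPoint M (fderiv ℝ F)) :
    FourPoint (6 * (M * M)) fun y => (fderiv ℝ F y).comp (F y) :=
  f₁.bilin f₀ b₁ b₀ (B := fun A B => A.comp B) (fun _ _ _ => ContinuousLinearMap.sub_comp _ _ _)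
    (fun _ _ _ => ContinuousLinearMap.comp_sub _ _ _) fun a b => a.opNorm_comp_le b

lemma norm_spair_comp_le (tops : TensorOps V V2 U W) {A : V →L[ℝ] U} {B : V →L[ℝ] U} {x : V2}
    {a b c : ℝ} (hA : ‖A‖ ≤ a) (hB : ‖B‖ ≤ b) (hx : ‖x‖ ≤ c) (H : U →L[ℝ] U →L[ℝ] W) :
    ‖tops.spair (H.comp A) B x‖ ≤ a * b * c * ‖H‖ := by
  have ha := (norm_nonneg _).trans hA
  have hb := (norm_nonneg _).trans hB
  calc _ ≤ ‖H.comp A‖ * ‖B‖ * ‖x‖ := tops.norm_spair_apply_le _ _ _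
    _ ≤ (‖H‖ * a) * b * c := by
        gcongr
        exact (H.opNorm_comp_le A).trans (by gcongr)
    _ = _ := by ring

lemma BoundedLip.spair {m a b c : ℝ} {H : W → U →L[ℝ] U →L[ℝ] W} (hH : BoundedLip m H)
    (tops : TensorOps V V2 U W) {A : V →L[ℝ] U} {B : V →L[ℝ] U} {x : V2}
    (hA : ‖A‖ ≤ a) (hB : ‖B‖ ≤ b) (hx : ‖x‖ ≤ c) :
    BoundedLip (a * b * c * m) fun y => tops.spair ((H y).comp A) B x := by
  have ha := (norm_nonneg _).trans hA
  have hb := (norm_nonneg _).trans hB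
  have hc := (norm_nonneg _).trans hx
  exact hH.map (g := fun H : U →L[ℝ] U →L[ℝ] W => tops.spair (H.comp A) B x) (by positivity)
    (fun a b => by simp [ContinuousLinearMap.sub_comp]) (norm_spair_comp_le tops hA hB hx)

lemma FourPoint.spair {m a b c : ℝ} {H : W → U →L[ℝ] U →L[ℝ] W} (hH : FourPoint m H)
    (tops : TensorOps V V2 U W) {A : V →L[ℝ] U} {B : V →L[ℝ] U} {x : V2}
    (hA : ‖A‖ ≤ a) (hB : ‖B‖ ≤ b) (hx : ‖x‖ ≤ c) :
    FourPoint (a * b * c * m) fun y => tops.spair ((H y).comp A) B x := by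
  have ha := (norm_nonneg _).trans hA
  have hb := (norm_nonneg _).trans hB
  have hc := (norm_nonneg _).trans hx
  exact hH.map (g := fun H : U →L[ℝ] U →L[ℝ] W => tops.spair (H.comp A) B x) (by positivity)
    (fun a b => by simp [ContinuousLinearMap.sub_comp]) (norm_spair_comp_le tops hA hB hx)

lemma BoundedLip.apply_const [NormedSpace ℝ E] {m c : ℝ} {G : E₁ → U →L[ℝ] E}
    (hG : BoundedLip m G) {z : U} (hz : ‖z‖ ≤ c) : BoundedLip (c * m) fun y => G y z :=
  hG.map (g := fun A : U →L[ℝ] E => A z) ((norm_nonneg _).trans hz) (fun _ _ => rfl) fun A => by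
    rw [mul_comm]; exact A.le_opNorm_of_le hz

lemma FourPoint.apply_const [NormedSpace ℝ E] {m c : ℝ} {G : E₁ → U →L[ℝ] E}
    (hG : FourPoint m G) {z : U} (hz : ‖z‖ ≤ c) : FourPoint (c * m) fun y => G y z :=
  hG.map (g := fun A : U →L[ℝ] E => A z) ((norm_nonneg _).trans hz) (fun _ _ => rfl) fun A => by
    rw [mul_comm]; exact A.le_opNorm_of_le hz

lemma DriverBound.boundedLip_germ (h : DriverBound T α C tops.tmul X XX Z Z')
    (b₀ : BoundedLip M F) (b₁ : BoundedLip M (fderiv ℝ F)) {s t a : ℝ} (hs : 0 ≤ s) (hst : s ≤ t)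
    (ht : t ≤ T) (ha : (t - s) ^ α ≤ a) (haC : a ≤ C) :
    BoundedLip ((C * M + 6 * M ^ 2 * C ^ 4) * a) fun y =>
      germ tops XX Z Z' (F y) ((fderiv ℝ F y).comp ((F y).comp (Z' s))) s t := by
  have hC := h.nonneg
  have ha' : 0 ≤ (t - s) ^ α := Real.rpow_nonneg (by linarith) _
  have ha0 := ha'.trans ha
  have i1 := b₀.apply_const ((h.integrator s t hs hst ht).trans
    (mul_le_mul_of_nonneg_left ha hC))
  have i2 := (b₀.fderiv_comp b₁).spair tops (h.deriv_le s hs (hst.trans ht))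
    (h.deriv_le s hs (hst.trans ht)) ((h.area s t hs hst ht).trans
    (mul_le_mul_of_nonneg_left (pow_le_pow_left₀ ha' ha 2) hC))
  refine (i1.add i2).mono ?_
  have : 0 ≤ C ^ 3 * M ^ 2 * a := by positivity
  have j1 := mul_le_mul_of_nonneg_left haC this
  have j2 : 0 ≤ C ^ 3 * M ^ 2 * a * C := by positivity
  linear_combination 2 * j1 + 4 * j2

lemma DriverBound.fourPoint_germ (h : DriverBound T α C tops.tmul X XX Z Z')
    (b₀ : BoundedLip M F) (b₁ : BoundedLip M (fderiv ℝ F)) (f₀ : FourPoint M F)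
    (f₁ : FourPoint M (fderiv ℝ F)) {s t : ℝ} (hs : 0 ≤ s) (hst : s ≤ t) (ht : t ≤ T) :
    FourPoint ((C * M + 6 * M ^ 2 * C ^ 4) * (t - s) ^ α) fun y =>
      germ tops XX Z Z' (F y) ((fderiv ℝ F y).comp ((F y).comp (Z' s))) s t := by
  have hC := h.nonneg
  have ha' : 0 ≤ (t - s) ^ α := Real.rpow_nonneg (by linarith) _
  have i1 := f₀.apply_const (h.integrator s t hs hst ht)
  have i2 := (FourPoint.fderiv_comp b₀ b₁ f₀ f₁).spair tops (h.deriv_le s hs (hst.trans ht))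
    (h.deriv_le s hs (hst.trans ht)) (h.area s t hs hst ht)
  refine (i1.add i2).mono ?_
  have : 0 ≤ C ^ 3 * M ^ 2 * (t - s) ^ α := by positivity
  have j1 := mul_le_mul_of_nonneg_left (h.time s t hs hst ht) this
  linear_combination 6 * j1

lemma DriverBound.exists_isAlmostFlow (h : DriverBound T α C tops.tmul X XX Z Z') (hα : 0 < α)
    (hF : Differentiable ℝ F)
    (b₀ : BoundedLip M F) (b₁ : BoundedLip M (fderiv ℝ F)) (f₀ : FourPoint M F)
    (f₁ : FourPoint M (fderiv ℝ F)) :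
    ∃ K, 0 ≤ K ∧ IsAlmostFlow T α (3 * α) K (rdeStep tops XX Z Z' F) := by
  have hC := h.nonneg
  have hM := b₀.nonneg
  set k : ℝ := C * M + 6 * M ^ 2 * C ^ 4 with hk
  set ρ : ℝ := C * M + C * C * C * (2 * (M * M)) with hρ
  set K : ℝ := C * (2 * (M * k ^ 2) + 2 * (M * ρ)) + (1 + C) * (C * C * C * (2 * (M * M)))
    + C * C * C * (2 * (6 * (M * M) * k)) + 2 * (C * C * C * (2 * (M * M))) with hK
  have hk0 : 0 ≤ k := by positivity
  have hρ0 : 0 ≤ ρ := by positivity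
  have hK0 : 0 ≤ K := by positivity
  have fH := FourPoint.fderiv_comp b₀ b₁ f₀ f₁
  have bH := b₀.fderiv_comp b₁
  refine ⟨k + K, by positivity, fun t x h0 h1 => ?_, fun s t hs hst ht => ?_,
    fun s u t hs hsu hut ht => ?_⟩
  · have : XX t t = 0 := by
      have := h.chen t t t h0 le_rfl le_rfl h1
      simpa using this
    simp [rdeStep, germ, this]
  · simp only [rdeStep, add_sub_cancel_left]
    refine (h.fourPoint_germ b₀ b₁ f₀ f₁ hs hst ht).mono ?_
    have : 0 ≤ (t - s) ^ α := Real.rpow_nonneg (by linarith) _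
    exact mul_le_mul_of_nonneg_right (by linarith) this
  · have hu0 := hs.trans hsu
    have huT := hut.trans ht
    set a : ℝ := (t - s) ^ α with ha
    have ha0 : 0 ≤ a := Real.rpow_nonneg (by linarith) _
    have a₁ : (u - s) ^ α ≤ a := Real.rpow_le_rpow (by linarith) (by linarith) hα.le
    have a₂ : (t - u) ^ α ≤ a := Real.rpow_le_rpow (by linarith) (by linarith) hα.le
    have p₁ : 0 ≤ (u - s) ^ α := Real.rpow_nonneg (by linarith) _
    have p₂ : 0 ≤ (t - u) ^ α := Real.rpow_nonneg (by linarith) _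
    have up : ∀ {x : ℝ}, x ≤ a → C * x ≤ C * a := fun hx => mul_le_mul_of_nonneg_left hx hC
    have up2 : ∀ {x : ℝ}, 0 ≤ x → x ≤ a → C * x ^ 2 ≤ C * a ^ 2 := fun h0 hx =>
      mul_le_mul_of_nonneg_left (pow_le_pow_left₀ h0 hx 2) hC
    have xsu := (h.path s u hs hsu huT).trans (up a₁)
    have xut := (h.path u t hu0 hut ht).trans (up a₂)
    have zut := (h.integrator u t hu0 hut ht).trans (up a₂)
    have rsu := (h.rem s u hs hsu huT).trans (up2 p₁ a₁)
    have rut := (h.rem u t hu0 hut ht).trans (up2 p₂ a₂)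
    have Xsu := (h.area s u hs hsu huT).trans (up2 p₁ a₁)
    have Xut := (h.area u t hu0 hut ht).trans (up2 p₂ a₂)
    have dsu := (h.deriv s u hs hsu huT).trans (up a₁)
    have ds := h.deriv_le s hs (hsu.trans huT)
    have du := h.deriv_le u hu0 huT
    set H : W → U →L[ℝ] U →L[ℝ] W := fun y => (fderiv ℝ F y).comp (F y) with hH
    set w : W → W := fun y =>
      germ tops XX Z Z' (F y) ((fderiv ℝ F y).comp ((F y).comp (Z' s))) s u with hw
    have bw : BoundedLip (k * a) w :=
      h.boundedLip_germ b₀ b₁ hs hsu huT a₁ (h.time s t hs (hsu.trans hut) ht)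
    have taylor := BoundedLip.taylor hF f₁ hM bw
    have bv : BoundedLip (ρ * a ^ 2) fun y => F y (Z u - Z s - Z' s (X u - X s)) +
        tops.spair ((H y).comp (Z' s)) (Z' s) (XX s u) :=
      ((b₀.apply_const rsu).add (bH.spair tops ds ds Xsu)).mono (le_of_eq (by rw [hρ]; ring))
    have bg := taylor.add (b₁.bilin bv (B := fun A v => A v) (fun _ _ _ => rfl)
      (fun A b c => map_sub A b c) fun A v => A.le_opNorm v)
    have t₁ := bg.apply_const zut
    have hZx : ‖Z' s (X u - X s)‖ ≤ C * (C * a) :=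
      ((Z' s).le_of_opNorm_le ds _).trans (mul_le_mul_of_nonneg_left xsu hC)
    have t₂ := (bH.apply_const hZx).apply_const rut
    have hZd : ‖(Z' u - Z' s) (X t - X u)‖ ≤ C * a * (C * a) :=
      ((Z' u - Z' s).le_of_opNorm_le dsu _).trans
        (mul_le_mul_of_nonneg_left xut (by positivity))
    have t₃ := (bH.apply_const hZx).apply_const hZd
    have t₄ := (fH.boundedLip_shift (by positivity) bw).spair tops du du Xut
    have t₅ := bH.spair tops dsu du Xut
    have t₆ := bH.spair tops ds dsu Xut
    have total := ((t₁.add t₂).add t₃).add ((t₄.add t₅).add t₆)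
    have fin := total.mono (c' := (k + K) * (t - s) ^ (3 * α)) (by
      rw [rpow_three_mul (by linarith), ← ha]
      have : 0 ≤ k * a ^ 3 := by positivity
      rw [hK]
      linear_combination this)
    convert fin using 2 with y
    have e := germ_defect tops Z Z' (F y) (F (y + w y)) ((H y).comp (Z' s))
      ((H (y + w y)).comp (Z' u)) (h.chen s u t hs hsu hut ht)
    have ew : w y = F y (Z u - Z s) + tops.spair ((H y).comp (Z' s)) (Z' s) (XX s u) := rfl
    have es : rdeStep tops XX Z Z' F u t (rdeStep tops XX Z Z' F s u y) -
        rdeStep tops XX Z Z' F s t y = germ tops XX Z Z' (F y) ((H y).comp (Z' s)) s u +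
        germ tops XX Z Z' (F (y + w y)) ((H (y + w y)).comp (Z' u)) u t -
        germ tops XX Z Z' (F y) ((H y).comp (Z' s)) s t := by
      change (y + w y) + germ tops XX Z Z' (F (y + w y)) ((H (y + w y)).comp (Z' u)) u t -
        (y + germ tops XX Z Z' (F y) ((H y).comp (Z' s)) s t) = w y + _ - _
      abel
    rw [es, e]
    congr 1
    · congr 2
      congr 1
      have e1 : fderiv ℝ F y (w y) = fderiv ℝ F y (F y (Z u - Z s)) +
          fderiv ℝ F y (tops.spair ((H y).comp (Z' s)) (Z' s) (XX s u)) := by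
        rw [ew, map_add]
      have e2 : ((H y).comp (Z' s)) (X u - X s) = fderiv ℝ F y (F y (Z' s (X u - X s))) := rfl
      rw [e1, e2]
      simp only [map_add, map_sub]
      abel
    · simp only [ContinuousLinearMap.sub_comp, ContinuousLinearMap.comp_sub, map_sub,
        _root_.sub_apply]
      abel

end RoughEquation

section Solution

lemma exists_bound_of_local {T δ B : ℝ} {y : ℝ → E} (hδ : 0 < δ)
    (h : ∀ s t, 0 ≤ s → s ≤ t → t ≤ T → t - s ≤ δ → ‖y t - y s‖ ≤ B) :
    ∃ B', ∀ s t, 0 ≤ s → s ≤ t → t ≤ T → ‖y t - y s‖ ≤ B' := by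
  have key : ∀ n : ℕ, ∀ s t, 0 ≤ s → s ≤ t → t ≤ T → t - s ≤ n * δ → ‖y t - y s‖ ≤ n * B := by
    intro n
    induction n with
    | zero =>
      intro s t _ hst _ hn
      simp only [CharP.cast_eq_zero, zero_mul] at hn
      simp [le_antisymm (sub_nonpos.1 hn) hst]
    | succ n ih =>
      intro s t hs hst ht hn
      push_cast at hn ⊢
      have hB : 0 ≤ B := (norm_nonneg _).trans
        (h s s hs le_rfl (hst.trans ht) (by simpa using hδ.le))
      by_cases hd : t - s ≤ δ
      · have : 0 ≤ (n : ℝ) * B := by positivity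
        linarith [h s t hs hst ht hd]
      · have h₁ := ih s (t - δ) hs (by linarith) (by linarith) (by linarith)
        have h₂ := h (t - δ) t (by linarith) (by linarith) ht (by linarith)
        linarith [norm_sub_le_norm_sub_add_norm_sub (y t) (y (t - δ)) (y s)]
  obtain ⟨n, hn⟩ := exists_nat_ge (T / δ)
  rw [div_le_iff₀ hδ] at hn
  exact ⟨n * B, fun s t hs hst ht => key n s t hs hst ht (by linarith)⟩

lemma HBound.of_local {T β δ K B : ℝ} {A : ℝ → ℝ → E} (hδ : 0 < δ) (hβ : 0 ≤ β)
    (hB : ∀ s t, 0 ≤ s → s ≤ t → t ≤ T → ‖A s t‖ ≤ B)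
    (h : ∀ s t, 0 ≤ s → s ≤ t → t ≤ T → t - s ≤ δ → ‖A s t‖ ≤ K * (t - s) ^ β) :
    HBound T β A := by
  have hδβ : 0 < δ ^ β := Real.rpow_pos_of_pos hδ _
  refine ⟨max K (|B| / δ ^ β), fun s t hs hst ht => ?_⟩
  have hp : 0 ≤ (t - s) ^ β := Real.rpow_nonneg (by linarith) _
  by_cases hd : t - s ≤ δ
  · exact (h s t hs hst.le ht hd).trans (mul_le_mul_of_nonneg_right (le_max_left _ _) hp)
  · calc ‖A s t‖ ≤ |B| := (hB s t hs hst.le ht).trans (le_abs_self B)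
      _ = |B| / δ ^ β * δ ^ β := by field_simp
      _ ≤ |B| / δ ^ β * (t - s) ^ β := by
        gcongr
        linarith
      _ ≤ _ := mul_le_mul_of_nonneg_right (le_max_right _ _) hp

variable {V V2 W U : Type*} [NormedAddCommGroup V] [NormedSpace ℝ V]
  [NormedAddCommGroup V2] [NormedSpace ℝ V2] [NormedAddCommGroup W] [NormedSpace ℝ W]
  [NormedAddCommGroup U] [NormedSpace ℝ U]
  {T α C M : ℝ} {tops : TensorOps V V2 U W} {X : ℝ → V} {XX : ℝ → ℝ → V2} {Z : ℝ → U}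
  {Z' : ℝ → V →L[ℝ] U} {F : W → U →L[ℝ] W}

lemma IsRoughIntegral.hasMeshLimit {Y : ℝ → W} {Y' : ℝ → V →L[ℝ] W} {I : W} {t : ℝ} (ht : t ≤ T)
    (hY' : ∀ t, 0 ≤ t → t ≤ T → Y' t = (F (Y t)).comp (Z' t))
    (h : IsRoughIntegral tops XX (fun r => F (Y r)) (fun r => (fderiv ℝ F (Y r)).comp (Y' r))
      Z Z' 0 t I) :
    HasMeshLimit (fun s t => germ tops XX Z Z' (F (Y s))
      ((fderiv ℝ F (Y s)).comp ((F (Y s)).comp (Z' s))) s t) t I := by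
  intro ε hε
  obtain ⟨δ, hδ, H⟩ := h ε hε
  refine ⟨δ, hδ, fun n p hp hm => ?_⟩
  convert H n p hp hm using 3
  refine Finset.sum_congr rfl fun i hi => ?_
  have hi := hp.mem_Icc (Finset.mem_range.1 hi).le
  simp only [germ]
  rw [hY' (p i) hi.1 (hi.2.trans ht)]

lemma DriverBound.exists_germ_defect_le (h : DriverBound T α C tops.tmul X XX Z Z') (hα : 0 < α)
    (hF : Differentiable ℝ F) (b₀ : BoundedLip M F) (b₁ : BoundedLip M (fderiv ℝ F))
    (f₁ : FourPoint M (fderiv ℝ F)) {y : ℝ → W} {L : ℝ} (hL : 0 ≤ L)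
    (hy : ∀ s t, 0 ≤ s → s ≤ t → t ≤ T → ‖y t - y s‖ ≤ L * (t - s) ^ α)
    (hr : ∀ s t, 0 ≤ s → s ≤ t → t ≤ T →
      ‖y t - y s - F (y s) (Z' s (X t - X s))‖ ≤ L * ((t - s) ^ α) ^ 2) :
    ∃ K, 0 ≤ K ∧ ∀ s u t, 0 ≤ s → s ≤ u → u ≤ t → t ≤ T →
      ‖germ tops XX Z Z' (F (y s)) ((fderiv ℝ F (y s)).comp ((F (y s)).comp (Z' s))) s u +
        germ tops XX Z Z' (F (y u)) ((fderiv ℝ F (y u)).comp ((F (y u)).comp (Z' u))) u t -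
        germ tops XX Z Z' (F (y s)) ((fderiv ℝ F (y s)).comp ((F (y s)).comp (Z' s))) s t‖ ≤
      K * (t - s) ^ (3 * α) := by
  have hC := h.nonneg
  have hM := b₀.nonneg
  set H : W → U →L[ℝ] U →L[ℝ] W := fun y => (fderiv ℝ F y).comp (F y) with hH
  have bH : BoundedLip (2 * (M * M)) H := b₀.fderiv_comp b₁
  refine ⟨(2 * M * L ^ 2 + M * L) * C + 2 * (M * M) * (C * C) * C + 2 * (M * M) * (C * C) * (C * C)
    + (C * C * C * (2 * (M * M) * L) + C * C * C * (2 * (M * M)) + C * C * C * (2 * (M * M))),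
    by positivity, fun s u t hs hsu hut ht => ?_⟩
  have hu0 := hs.trans hsu
  have huT := hut.trans ht
  rw [rpow_three_mul (by linarith)]
  set a : ℝ := (t - s) ^ α with ha
  have ha0 : 0 ≤ a := Real.rpow_nonneg (by linarith) _
  have a₁ : (u - s) ^ α ≤ a := Real.rpow_le_rpow (by linarith) (by linarith) hα.le
  have a₂ : (t - u) ^ α ≤ a := Real.rpow_le_rpow (by linarith) (by linarith) hα.le
  have p₁ : 0 ≤ (u - s) ^ α := Real.rpow_nonneg (by linarith) _
  have p₂ : 0 ≤ (t - u) ^ α := Real.rpow_nonneg (by linarith) _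
  have up : ∀ {c x : ℝ}, 0 ≤ c → x ≤ a → c * x ≤ c * a := fun hc hx =>
    mul_le_mul_of_nonneg_left hx hc
  have up2 : ∀ {c x : ℝ}, 0 ≤ c → 0 ≤ x → x ≤ a → c * x ^ 2 ≤ c * a ^ 2 := fun hc h0 hx =>
    mul_le_mul_of_nonneg_left (pow_le_pow_left₀ h0 hx 2) hc
  have xsu := (h.path s u hs hsu huT).trans (up hC a₁)
  have xut := (h.path u t hu0 hut ht).trans (up hC a₂)
  have zut := (h.integrator u t hu0 hut ht).trans (up hC a₂)
  have rut := (h.rem u t hu0 hut ht).trans (up2 hC p₂ a₂)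
  have Xut := (h.area u t hu0 hut ht).trans (up2 hC p₂ a₂)
  have dsu := (h.deriv s u hs hsu huT).trans (up hC a₁)
  have ds := h.deriv_le s hs (hsu.trans huT)
  have du := h.deriv_le u hu0 huT
  have ysu := (hy s u hs hsu huT).trans (up hL a₁)
  have qsu := (hr s u hs hsu huT).trans (up2 hL p₁ a₁)
  have hZx : ‖Z' s (X u - X s)‖ ≤ C * (C * a) :=
    ((Z' s).le_of_opNorm_le ds _).trans (mul_le_mul_of_nonneg_left xsu hC)
  have hZd : ‖(Z' u - Z' s) (X t - X u)‖ ≤ C * a * (C * a) :=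
    ((Z' u - Z' s).le_of_opNorm_le dsu _).trans (mul_le_mul_of_nonneg_left xut (by positivity))
  have hHx : ‖H (y s) (Z' s (X u - X s))‖ ≤ 2 * (M * M) * (C * (C * a)) :=
    (H (y s)).le_of_opNorm_le_of_le (bH.1 _) hZx
  have taylor : ‖F (y u) - F (y s) - fderiv ℝ F (y s) (y u - y s)‖ ≤ 2 * (M * (L * a) ^ 2) := by
    have bw : BoundedLip (L * a) fun _ : W => y u - y s :=
      ⟨fun _ => ysu, fun x x' => by rw [sub_self, norm_zero]; positivity⟩
    simpa using (BoundedLip.taylor hF f₁ hM bw).1 (y s)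
  have hG : ‖F (y u) - F (y s) - H (y s) (Z' s (X u - X s))‖ ≤
      2 * (M * (L * a) ^ 2) + M * (L * a ^ 2) := by
    have e : F (y u) - F (y s) - H (y s) (Z' s (X u - X s)) =
        (F (y u) - F (y s) - fderiv ℝ F (y s) (y u - y s)) +
        fderiv ℝ F (y s) (y u - y s - F (y s) (Z' s (X u - X s))) := by
      simp only [map_sub, hH, ContinuousLinearMap.comp_apply]
      abel
    rw [e]
    exact norm_add_le_of_le taylor ((fderiv ℝ F (y s)).le_of_opNorm_le_of_le (b₁.1 _) qsu)
  have hHd : ‖H (y u) - H (y s)‖ ≤ 2 * (M * M) * (L * a) :=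
    (bH.2 _ _).trans (mul_le_mul_of_nonneg_left ysu (by positivity))
  have hsp : ‖tops.spair ((H (y u)).comp (Z' u)) (Z' u) (XX u t) -
      tops.spair ((H (y s)).comp (Z' s)) (Z' s) (XX u t)‖ ≤
      C * C * (C * a ^ 2) * (2 * (M * M) * (L * a)) + C * a * C * (C * a ^ 2) * (2 * (M * M)) +
        C * (C * a) * (C * a ^ 2) * (2 * (M * M)) := by
    have e : tops.spair ((H (y u)).comp (Z' u)) (Z' u) (XX u t) -
        tops.spair ((H (y s)).comp (Z' s)) (Z' s) (XX u t) =
        tops.spair ((H (y u) - H (y s)).comp (Z' u)) (Z' u) (XX u t) +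
        tops.spair ((H (y s)).comp (Z' u - Z' s)) (Z' u) (XX u t) +
        tops.spair ((H (y s)).comp (Z' s)) (Z' u - Z' s) (XX u t) := by
      simp only [ContinuousLinearMap.sub_comp, ContinuousLinearMap.comp_sub, map_sub,
        _root_.sub_apply]
      abel
    rw [e]
    refine norm_add_le_of_le (norm_add_le_of_le
      ((norm_spair_comp_le tops du du Xut _).trans ?_)
      ((norm_spair_comp_le tops dsu du Xut _).trans ?_))
      ((norm_spair_comp_le tops ds dsu Xut _).trans ?_)
    · exact mul_le_mul_of_nonneg_left hHd (by positivity)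
    · exact mul_le_mul_of_nonneg_left (bH.1 _) (by positivity)
    · exact mul_le_mul_of_nonneg_left (bH.1 _) (by positivity)
  have e := germ_defect tops Z Z' (F (y s)) (F (y u)) ((H (y s)).comp (Z' s))
    ((H (y u)).comp (Z' u)) (h.chen s u t hs hsu hut ht)
  have total := norm_add_le_of_le (norm_add_le_of_le (norm_add_le_of_le
    ((F (y u) - F (y s) - H (y s) (Z' s (X u - X s))).le_of_opNorm_le_of_le hG zut)
    ((H (y s) (Z' s (X u - X s))).le_of_opNorm_le_of_le hHx rut))
    ((H (y s) (Z' s (X u - X s))).le_of_opNorm_le_of_le hHx hZd)) hsp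
  change ‖germ tops XX Z Z' (F (y s)) ((H (y s)).comp (Z' s)) s u +
    germ tops XX Z Z' (F (y u)) ((H (y u)).comp (Z' u)) u t -
    germ tops XX Z Z' (F (y s)) ((H (y s)).comp (Z' s)) s t‖ ≤ _
  rw [e]
  exact total.trans (le_of_eq (by ring))

/-- A controlled solution of the rough differential equation is a trajectory of its one-step map. -/
lemma DriverBound.isDaviePath_of_isRoughIntegral [CompleteSpace W]
    (h : DriverBound T α C tops.tmul X XX Z Z') (hT : 0 ≤ T) (hα : 1 / 3 < α)
    (hF : Differentiable ℝ F) (b₀ : BoundedLip M F) (b₁ : BoundedLip M (fderiv ℝ F))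
    (f₁ : FourPoint M (fderiv ℝ F)) {Y : ℝ → W} {Y' : ℝ → V →L[ℝ] W} {y₀ : W}
    (hY : IsCRP T α X Y Y') (hY' : ∀ t, 0 ≤ t → t ≤ T → Y' t = (F (Y t)).comp (Z' t))
    (hI : ∀ t, 0 ≤ t → t ≤ T → IsRoughIntegral tops XX (fun r => F (Y r))
      (fun r => (fderiv ℝ F (Y r)).comp (Y' r)) Z Z' 0 t (Y t - y₀)) :
    IsDaviePath T (3 * α) (rdeStep tops XX Z Z' F) Y := by
  have hC := h.nonneg
  have hM := b₀.nonneg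
  obtain ⟨L, hL, hr⟩ := hY.rem_hold.exists_nonneg fun t _ _ => by simp [Rem]
  have hr' : ∀ s t, 0 ≤ s → s ≤ t → t ≤ T →
      ‖Y t - Y s - F (Y s) (Z' s (X t - X s))‖ ≤ L * ((t - s) ^ α) ^ 2 := by
    intro s t hs hst ht
    have := hr s t hs hst ht
    rwa [Rem, hY' s hs (hst.trans ht), rpow_two_mul (by linarith)] at this
  have hm : ∀ s t, 0 ≤ s → s ≤ t → t ≤ T → ‖Y t - Y s‖ ≤ (L * C + M * (C * C)) * (t - s) ^ α := by
    intro s t hs hst ht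
    have ha : 0 ≤ (t - s) ^ α := Real.rpow_nonneg (by linarith) _
    have e₁ := hr' s t hs hst ht
    have e₂ := (F (Y s)).le_of_opNorm_le_of_le (b₀.1 _)
      ((Z' s).le_of_opNorm_le_of_le (h.deriv_le s hs (hst.trans ht)) (h.path s t hs hst ht))
    have e₃ := norm_add_le_of_le e₁ e₂
    rw [sub_add_cancel] at e₃
    have e₄ := mul_le_mul_of_nonneg_left (h.time s t hs hst ht) (mul_nonneg hL ha)
    linear_combination e₃ + e₄
  obtain ⟨K, hK, hd⟩ := h.exists_germ_defect_le (by linarith) hF b₀ b₁ f₁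
    (L := L + (L * C + M * (C * C))) (by positivity)
    (fun s t hs hst ht => (hm s t hs hst ht).trans (mul_le_mul_of_nonneg_right (by linarith)
      (Real.rpow_nonneg (by linarith) _)))
    (fun s t hs hst ht => (hr' s t hs hst ht).trans (mul_le_mul_of_nonneg_right
      (le_add_of_nonneg_right (by positivity)) (by positivity)))
  set Ξ : ℝ → ℝ → W := fun s t =>
    germ tops XX Z Z' (F (Y s)) ((fderiv ℝ F (Y s)).comp ((F (Y s)).comp (Z' s))) s t with hΞ
  have hΞ₀ : ∀ t, 0 ≤ t → t ≤ T → Ξ t t = 0 := fun t h₀ h₁ => by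
    have : XX t t = 0 := by simpa using h.chen t t t h₀ le_rfl le_rfl h₁
    simp [hΞ, germ, this]
  obtain ⟨I, hI₀, L', δ, hL', hδ, hI'⟩ :=
    (isAlmostFlow_add (α := α) hK hΞ₀ hd).exists_isDaviePath hT (by linarith) (by linarith) hK 0
  have key : ∀ t, 0 ≤ t → t ≤ T → Y t - y₀ = I t := fun t h₀ h₁ => by
    have lim := hasMeshLimit_of_davie (Ξ := Ξ) (y := I) (T := T) (θ := 3 * α) (by linarith)
      ⟨L', δ, hL', hδ, fun s t hs hst ht hd => by
        rw [sub_sub]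
        exact hI' s t hs hst ht hd⟩ h₁
    rw [hI₀, sub_zero] at lim
    exact (IsRoughIntegral.hasMeshLimit h₁ hY' (hI t h₀ h₁)).unique h₀ lim
  refine ⟨L', δ, hL', hδ, fun s t hs hst ht hd => ?_⟩
  have e : Y t - rdeStep tops XX Z Z' F s t (Y s) = I t - (I s + Ξ s t) := by
    rw [← key t (hs.trans hst) ht, ← key s hs (hst.trans ht)]
    simp only [rdeStep, hΞ]
    abel
  rw [e]
  exact hI' s t hs hst ht hd

lemma isRoughIntegral_of_isDaviePath {θ : ℝ} (hθ : 1 < θ) {Y : ℝ → W}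
    (hY : IsDaviePath T θ (rdeStep tops XX Z Z' F) Y) {t : ℝ} (ht : t ≤ T) :
    IsRoughIntegral tops XX (fun r => F (Y r))
      (fun r => (fderiv ℝ F (Y r)).comp ((F (Y r)).comp (Z' r))) Z Z' 0 t (Y t - Y 0) := by
  obtain ⟨L, δ, hL, hδ, h⟩ := hY
  refine hasMeshLimit_of_davie (Ξ := fun s t => germ tops XX Z Z' (F (Y s))
    ((fderiv ℝ F (Y s)).comp ((F (Y s)).comp (Z' s))) s t) hθ
    ⟨L, δ, hL, hδ, fun s t hs hst ht hd => ?_⟩ ht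
  rw [sub_sub]
  exact h s t hs hst ht hd

/-- Trajectories of the one-step map are controlled paths. -/
lemma DriverBound.isCRP_of_isDaviePath (h : DriverBound T α C tops.tmul X XX Z Z') (hα : 0 < α)
    (b₀ : BoundedLip M F) (b₁ : BoundedLip M (fderiv ℝ F)) {Y : ℝ → W}
    (hY : IsDaviePath T (3 * α) (rdeStep tops XX Z Z' F) Y) :
    IsCRP T α X Y fun t => (F (Y t)).comp (Z' t) := by
  have hC := h.nonneg
  have hM := b₀.nonneg
  obtain ⟨L, δ, hL, hδ, hl⟩ := hY
  set k : ℝ := C * M + 6 * M ^ 2 * C ^ 4 with hk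
  have hk0 : 0 ≤ k := by positivity
  have inc : ∀ s t, 0 ≤ s → s ≤ t → t ≤ T → t - s ≤ δ →
      ‖Y t - Y s‖ ≤ (L * (C * C) + k) * (t - s) ^ α := by
    intro s t hs hst ht hd
    have ha : 0 ≤ (t - s) ^ α := Real.rpow_nonneg (by linarith) _
    have haC := h.time s t hs hst ht
    have e₁ := hl s t hs hst ht hd
    rw [rpow_three_mul (by linarith)] at e₁
    have e₂ := (h.boundedLip_germ b₀ b₁ hs hst ht le_rfl haC).1 (Y s)
    have e₃ := norm_add_le_of_le e₁ e₂
    rw [rdeStep, sub_add_eq_sub_sub, sub_add_cancel] at e₃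
    have e₄ : L * ((t - s) ^ α) ^ 3 ≤ L * (C * C) * (t - s) ^ α := by
      rw [show L * ((t - s) ^ α) ^ 3 = L * ((t - s) ^ α * (t - s) ^ α) * (t - s) ^ α by ring]
      gcongr
    linear_combination e₃ + e₄
  obtain ⟨B, hB⟩ := exists_bound_of_local (y := Y) hδ fun s t hs hst ht hd =>
    (inc s t hs hst ht hd).trans (mul_le_mul_of_nonneg_left (h.time s t hs hst ht) (by positivity))
  obtain ⟨H, hH0, hH⟩ := (HBound.of_local hδ hα.le hB inc).exists_nonneg fun t _ _ => sub_self _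
  refine ⟨⟨M * C + H * M * C, fun s t hs hst ht => ?_⟩, HBound.of_local hδ (by positivity)
    (K := L * C + M * C + C * C * C * (2 * (M * M))) (B := B + M * (C * (C * C)))
    (fun s t hs hst ht => ?_) fun s t hs hst ht hd => ?_⟩
  · have e₁ := h.deriv s t hs hst.le ht
    have e₂ := (b₀.2 (Y t) (Y s)).trans (mul_le_mul_of_nonneg_left (hH s t hs hst.le ht) hM)
    have e : (F (Y t)).comp (Z' t) - (F (Y s)).comp (Z' s) =
        (F (Y t)).comp (Z' t - Z' s) + (F (Y t) - F (Y s)).comp (Z' s) := by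
      simp only [ContinuousLinearMap.comp_sub, ContinuousLinearMap.sub_comp]
      abel
    have ha : 0 ≤ (t - s) ^ α := Real.rpow_nonneg (by linarith) _
    dsimp only
    rw [e]
    have n₁ := ((F (Y t)).opNorm_comp_le (Z' t - Z' s)).trans
      (mul_le_mul (b₀.1 _) e₁ (norm_nonneg _) hM)
    have n₂ := ((F (Y t) - F (Y s)).opNorm_comp_le (Z' s)).trans
      (mul_le_mul e₂ (h.deriv_le s hs (hst.le.trans ht)) (norm_nonneg _) (by positivity))
    linear_combination norm_add_le_of_le n₁ n₂
  · refine norm_sub_le_of_le (hB s t hs hst ht) ?_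
    refine (F (Y s)).le_of_opNorm_le_of_le (b₀.1 _)
      ((Z' s).le_of_opNorm_le_of_le (h.deriv_le s hs (hst.trans ht)) ?_)
    exact (h.path s t hs hst ht).trans (mul_le_mul_of_nonneg_left (h.time s t hs hst ht) hC)
  · have ha : 0 ≤ (t - s) ^ α := Real.rpow_nonneg (by linarith) _
    have haC := h.time s t hs hst ht
    have ds := h.deriv_le s hs (hst.trans ht)
    have e₁ := hl s t hs hst ht hd
    rw [rpow_three_mul (by linarith)] at e₁
    have e₂ := (F (Y s)).le_of_opNorm_le_of_le (b₀.1 _) (h.rem s t hs hst ht)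
    have e₃ := ((b₀.fderiv_comp b₁).spair tops ds ds (h.area s t hs hst ht)).1 (Y s)
    have e₄ : L * ((t - s) ^ α) ^ 3 ≤ L * C * ((t - s) ^ α) ^ 2 := by
      rw [show L * ((t - s) ^ α) ^ 3 = L * (t - s) ^ α * ((t - s) ^ α) ^ 2 by ring]
      gcongr
    have e : Rem X Y (fun t => (F (Y t)).comp (Z' t)) s t =
        (Y t - rdeStep tops XX Z Z' F s t (Y s)) + F (Y s) (Z t - Z s - Z' s (X t - X s)) +
        tops.spair (((fderiv ℝ F (Y s)).comp (F (Y s))).comp (Z' s)) (Z' s) (XX s t) := by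
      simp only [Rem, rdeStep, germ, map_sub, ContinuousLinearMap.comp_apply,
        ContinuousLinearMap.comp_assoc]
      abel
    rw [e, rpow_two_mul (by linarith)]
    linear_combination norm_add_le_of_le (norm_add_le_of_le e₁ e₂) e₃ + e₄

end Solution

end Auxiliary

/-- global existence and uniqueness for the rough differential
equation `dY = F(Y) dZ` driven by a controlled rough path `𝐙` on `[0,T]`. -/
theorem stmt15
    {V V2 W U : Type*} [NormedAddCommGroup V] [NormedSpace ℝ V] [CompleteSpace V]
    [NormedAddCommGroup V2] [NormedSpace ℝ V2] [CompleteSpace V2]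
    [NormedAddCommGroup W] [NormedSpace ℝ W] [CompleteSpace W]
    [NormedAddCommGroup U] [NormedSpace ℝ U] [CompleteSpace U]
    (T α : ℝ) (hT : 0 < T) (hα : 1 / 3 < α) (hα' : α ≤ 1 / 2)
    (tops : TensorOps V V2 U W) (X : ℝ → V) (XX : ℝ → ℝ → V2)
    (hX : IsRoughPath T α tops.tmul X XX)
    (Z : ℝ → U) (Z' : ℝ → V →L[ℝ] U) (hZ : IsCRP T α X Z Z')
    (F : W → U →L[ℝ] W) (hF : IsCb 3 F) (y₀ : W) :
    ∃ (Y : ℝ → W) (Y' : ℝ → V →L[ℝ] W),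
      (IsCRP T α X Y Y' ∧ Y 0 = y₀ ∧
        (∀ t : ℝ, 0 ≤ t → t ≤ T → Y' t = (F (Y t)).comp (Z' t)) ∧
        (∀ t : ℝ, 0 ≤ t → t ≤ T →
          IsRoughIntegral tops XX (fun r => F (Y r))
            (fun r => (fderiv ℝ F (Y r)).comp (Y' r)) Z Z' 0 t (Y t - y₀))) ∧
      ∀ (Yt : ℝ → W) (Yt' : ℝ → V →L[ℝ] W),
        IsCRP T α X Yt Yt' → Yt 0 = y₀ →
        (∀ t : ℝ, 0 ≤ t → t ≤ T → Yt' t = (F (Yt t)).comp (Z' t)) →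
        (∀ t : ℝ, 0 ≤ t → t ≤ T →
          IsRoughIntegral tops XX (fun r => F (Yt r))
            (fun r => (fderiv ℝ F (Yt r)).comp (Yt' r)) Z Z' 0 t (Yt t - y₀)) →
        ∀ t : ℝ, 0 ≤ t → t ≤ T → Yt t = Y t ∧ Yt' t = Y' t := by
  have hα₀ : 0 < α := by linarith
  obtain ⟨C, h⟩ := hX.exists_driverBound hα₀ hZ
  obtain ⟨M₁, b₀⟩ := hF.exists_boundedLip
  obtain ⟨M₂, b₁⟩ := hF.fderiv_right.exists_boundedLip
  obtain ⟨M₃, f₀⟩ := hF.exists_fourPoint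
  obtain ⟨M₄, f₁⟩ := hF.fderiv_right.exists_fourPoint
  set M : ℝ := max (max M₁ M₂) (max M₃ M₄) with hM
  replace b₀ : BoundedLip M F := b₀.mono (by simp [hM])
  replace b₁ : BoundedLip M (fderiv ℝ F) := b₁.mono (by simp [hM])
  replace f₀ : FourPoint M F := f₀.mono (by simp [hM])
  replace f₁ : FourPoint M (fderiv ℝ F) := f₁.mono (by simp [hM])
  obtain ⟨K, hK, flow⟩ := h.exists_isAlmostFlow hα₀ hF.differentiable b₀ b₁ f₀ f₁
  have hθ : 1 < 3 * α := by linarith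
  obtain ⟨Y, hY₀, hY⟩ := flow.exists_isDaviePath hT.le hα₀ hθ hK y₀
  refine ⟨Y, fun t => (F (Y t)).comp (Z' t), ⟨h.isCRP_of_isDaviePath hα₀ b₀ b₁ hY, hY₀,
    fun _ _ _ => rfl, fun t _ ht => ?_⟩, fun Yt Yt' hYt hYt₀ hYt' hI t h₀ ht => ?_⟩
  · rw [← hY₀]
    exact isRoughIntegral_of_isDaviePath hθ hY ht
  · have e : Yt t = Y t := IsDaviePath.eq flow hT.le hα₀ hθ hK
      (h.isDaviePath_of_isRoughIntegral hT.le hα hF.differentiable b₀ b₁ f₁ hYt hYt' hI)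
      hY (hYt₀.trans hY₀.symm) h₀ ht
    exact ⟨e, by rw [hYt' t h₀ ht, e]⟩
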